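/- arXiv:2408.13458 — 4 statements merged into one kernel-verified Lean document; each statement's English description precedes it below -/
import Mathlib

section
/- There exists N₀ such that for every integer N ≥ N₀ and every integer n with (1−δ)N ≤ n ≤ N, one has 𝔍(n) > 2.338190371 · N^{10/9}. -/
open MeasureTheory Finset
open scoped Classical

noncomputable section

/-- `eu x = e(x) = exp(2πix)`. -/
def eu (x : ℝ) : ℂ := Complex.exp (2 * Real.pi * Complex.I * x)

/-- `Cq i q a = ∑_{1 ≤ m ≤ q, gcd(m,q)=1} e(a m^i / q)`. -/
def Cq (i q a : ℕ) : ℂ :=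
  ∑ m ∈ (Finset.Icc 1 q).filter (fun m => Nat.gcd m q = 1), eu ((a * m ^ i : ℝ) / q)

/-- `Afun n q = Re( μ(q)/φ(q)^4 · ∑_{1 ≤ a ≤ q, (a,q)=1} C₂(q,a) C₃(q,a)² e(-an/q) )`. -/
def Afun (n q : ℕ) : ℝ :=
  (((ArithmeticFunction.moebius q : ℤ) : ℂ) / ((Nat.totient q : ℂ)) ^ 4 *
    ∑ a ∈ (Finset.Icc 1 q).filter (fun a => Nat.gcd a q = 1),
      Cq 2 q a * (Cq 3 q a) ^ 2 * eu (-(a * n : ℝ) / q)).re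

/-- the singular series `𝔖(n) = ∑_{q=1}^∞ A(n,q)`. -/
def SSfun (n : ℕ) : ℝ := ∑' q : ℕ+, Afun n (q : ℕ)

/-- `U = (N/(16(1+δ)))^{1/3}` with `δ = 10⁻⁴`. -/
def Uconst (N : ℕ) : ℝ := ((N : ℝ) / (16 * (1 + 1e-4))) ^ ((1 : ℝ) / 3)

/-- `V = U^{5/6}`. -/
def Vconst (N : ℕ) : ℝ := Uconst N ^ ((5 : ℝ) / 6)

/-- `f(α) = ∑_{p ≤ N} (log p) e(pα)`. -/
def fsum (N : ℕ) (α : ℝ) : ℂ :=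
  ∑ p ∈ (Finset.range (N + 1)).filter Nat.Prime, (Real.log p : ℂ) * eu (p * α)

/-- `g(α) = ∑_{p ≤ N^{1/2}} (log p) e(p²α)`. -/
def gsum (N : ℕ) (α : ℝ) : ℂ :=
  ∑ p ∈ (Finset.range (N + 1)).filter (fun p : ℕ => p.Prime ∧ (p : ℝ) ≤ Real.sqrt N),
    (Real.log p : ℂ) * eu ((p : ℝ) ^ 2 * α)

/-- `∑_{X < p ≤ 2X} (log p) e(p³α)`; `S = cubeSum U`, `T = cubeSum V`. -/
def cubeSum (X : ℝ) (α : ℝ) : ℂ :=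
  ∑ p ∈ (Finset.range (⌊2 * X⌋₊ + 1)).filter
      (fun p : ℕ => p.Prime ∧ X < (p : ℝ) ∧ (p : ℝ) ≤ 2 * X),
    (Real.log p : ℂ) * eu ((p : ℝ) ^ 3 * α)

/-- `G(α) = ∑_{1 ≤ v ≤ L} e(2^v α)`. -/
def Gsum (L : ℝ) (α : ℝ) : ℂ := ∑ v ∈ Finset.Icc 1 ⌊L⌋₊, eu ((2 : ℝ) ^ v * α)

/-- the major arcs `𝔐 = ⋃_{q ≤ P} ⋃_{1 ≤ a ≤ q, (a,q)=1} {α ∈ [0,1] : |α - a/q| ≤ 1/(qQ)}`. -/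
def majorArcs (P Q : ℝ) : Set ℝ :=
  {α | α ∈ Set.Icc (0 : ℝ) 1 ∧ ∃ q a : ℕ, 1 ≤ q ∧ (q : ℝ) ≤ P ∧ 1 ≤ a ∧ a ≤ q ∧
    Nat.gcd a q = 1 ∧ |α - (a : ℝ) / q| ≤ 1 / ((q : ℝ) * Q)}

/-- the minor arcs `C(𝔐) = [1/Q, 1 + 1/Q] \ 𝔐`. -/
def minorArcs (P Q : ℝ) : Set ℝ := Set.Icc (1 / Q) (1 + 1 / Q) \ majorArcs P Q

/-- `𝔍(n)`: the sum of `m₂^{-1/2} (m₃ m₄)^{-2/3}` over quadruples of positive integers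
`m₁ + m₂ + m₃ + m₄ = n` with `m₁, m₂ ≤ N`, `U³ ≤ m₃ ≤ 8U³`, `V³ ≤ m₄ ≤ 8V³`. -/
def Jfun (N n : ℕ) : ℝ :=
  ∑ m ∈ (((Finset.Icc 1 n ×ˢ Finset.Icc 1 n) ×ˢ (Finset.Icc 1 n ×ˢ Finset.Icc 1 n)).filter
      (fun m => m.1.1 + m.1.2 + m.2.1 + m.2.2 = n ∧ m.1.1 ≤ N ∧ m.1.2 ≤ N ∧
        Uconst N ^ 3 ≤ (m.2.1 : ℝ) ∧ (m.2.1 : ℝ) ≤ 8 * Uconst N ^ 3 ∧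
        Vconst N ^ 3 ≤ (m.2.2 : ℝ) ∧ (m.2.2 : ℝ) ≤ 8 * Vconst N ^ 3)),
    (m.1.2 : ℝ) ^ (-(1 : ℝ) / 2) * ((m.2.1 : ℝ) * (m.2.2 : ℝ)) ^ (-(2 : ℝ) / 3)

lemma half_term (k : ℕ) (hk : 1 ≤ k) :
    2 * (√((k : ℝ) + 1) - √(k : ℝ)) ≤ (k : ℝ) ^ (-(1 : ℝ) / 2) := by
  have hk0 : (0 : ℝ) < k := by exact_mod_cast hk
  have e : (k : ℝ) ^ (-(1 : ℝ) / 2) = (√(k : ℝ))⁻¹ := by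
    rw [Real.sqrt_eq_rpow, ← Real.rpow_neg hk0.le]; norm_num
  rw [e]
  have hs : 0 < √(k : ℝ) := Real.sqrt_pos.2 hk0
  have h1 : √(k : ℝ) ^ 2 = k := Real.sq_sqrt hk0.le
  have h2 : √((k : ℝ) + 1) ^ 2 = k + 1 := Real.sq_sqrt (by positivity)
  rw [← one_div, le_div_iff₀ hs]
  nlinarith [sq_nonneg (√((k : ℝ) + 1) - √(k : ℝ))]

lemma half_sum (M : ℕ) :
    2 * (√((M : ℝ) + 1) - 1) ≤ ∑ m ∈ Finset.Icc 1 M, (m : ℝ) ^ (-(1 : ℝ) / 2) := by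
  induction M with
  | zero => simp
  | succ k ih =>
    rw [Finset.sum_Icc_succ_top (by omega)]
    have := half_term (k + 1) (by omega)
    push_cast at this ⊢
    linarith

lemma third_term (k : ℕ) (hk : 1 ≤ k) :
    3 * (((k : ℝ) + 1) ^ ((1 : ℝ) / 3) - (k : ℝ) ^ ((1 : ℝ) / 3)) ≤ (k : ℝ) ^ (-(2 : ℝ) / 3) := by
  have hk0 : (0 : ℝ) < k := by exact_mod_cast hk
  obtain ⟨a, ha⟩ : ∃ a, a = (k : ℝ) ^ ((1 : ℝ) / 3) := ⟨_, rfl⟩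
  obtain ⟨b, hb⟩ : ∃ b, b = ((k : ℝ) + 1) ^ ((1 : ℝ) / 3) := ⟨_, rfl⟩
  have ha0 : 0 < a := by rw [ha]; positivity
  have hb0 : 0 < b := by rw [hb]; positivity
  have ha3 : a ^ 3 = k := by
    rw [ha, ← Real.rpow_natCast, ← Real.rpow_mul hk0.le]; norm_num
  have hb3 : b ^ 3 = k + 1 := by
    rw [hb, ← Real.rpow_natCast, ← Real.rpow_mul (by positivity)]; norm_num
  have e : (k : ℝ) ^ (-(2 : ℝ) / 3) = (a ^ 2)⁻¹ := by
    rw [ha, ← Real.rpow_natCast, ← Real.rpow_mul hk0.le, ← Real.rpow_neg hk0.le]; norm_num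
  rw [e, ← ha, ← hb, ← one_div, le_div_iff₀ (by positivity)]
  nlinarith [mul_nonneg (sq_nonneg (b - a)) (by positivity : 0 ≤ b + 2 * a)]

lemma third_sum (p q : ℕ) (hpq : p ≤ q) :
    3 * (((q : ℝ) + 1) ^ ((1 : ℝ) / 3) - ((p : ℝ) + 1) ^ ((1 : ℝ) / 3)) ≤
      ∑ m ∈ Finset.Ioc p q, (m : ℝ) ^ (-(2 : ℝ) / 3) := by
  induction q, hpq using Nat.le_induction with
  | base => simp
  | succ k hk ih =>
    rw [Finset.sum_Ioc_succ_top (by omega)]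
    have := third_term (k + 1) (by omega)
    push_cast at this ⊢
    linarith

/-- block sum over `a³ < m ≤ b³`. -/
lemma block_sum (a b : ℝ) (ha : 0 ≤ a) (hab : a ≤ b) :
    3 * (b - a - 1) ≤ ∑ m ∈ Finset.Ioc ⌊a ^ 3⌋₊ ⌊b ^ 3⌋₊, (m : ℝ) ^ (-(2 : ℝ) / 3) := by
  have h3 : a ^ 3 ≤ b ^ 3 := by gcongr
  refine le_trans ?_ (third_sum _ _ (Nat.floor_le_floor h3))
  have hb : 0 ≤ b := ha.trans hab
  have h1 : b ≤ ((⌊b ^ 3⌋₊ : ℝ) + 1) ^ ((1 : ℝ) / 3) := by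
    have : b = (b ^ 3) ^ ((1 : ℝ) / 3) := by
      rw [← Real.rpow_natCast, ← Real.rpow_mul hb]; norm_num
    conv_lhs => rw [this]
    exact Real.rpow_le_rpow (by positivity) (Nat.lt_floor_add_one _).le (by norm_num)
  have h2 : ((⌊a ^ 3⌋₊ : ℝ) + 1) ^ ((1 : ℝ) / 3) ≤ a + 1 := by
    have : a + 1 = ((a + 1) ^ 3) ^ ((1 : ℝ) / 3) := by
      rw [← Real.rpow_natCast, ← Real.rpow_mul (by positivity)]; norm_num
    rw [this]
    refine Real.rpow_le_rpow (by positivity) ?_ (by norm_num)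
    have := Nat.floor_le (by positivity : 0 ≤ a ^ 3)
    nlinarith [sq_nonneg a]
  linarith

lemma half_sum' (s : ℝ) (hs : 0 ≤ s) :
    2 * (s - 1) ≤ ∑ m ∈ Finset.Icc 1 ⌊s ^ 2⌋₊, (m : ℝ) ^ (-(1 : ℝ) / 2) := by
  refine le_trans ?_ (half_sum _)
  have : s ≤ √((⌊s ^ 2⌋₊ : ℝ) + 1) :=
    Real.le_sqrt_of_sq_le (Nat.lt_floor_add_one _).le
  linarith

def trip : (ℕ × ℕ) × (ℕ × ℕ) → ℝ := fun m =>
  (m.1.2 : ℝ) ^ (-(1 : ℝ) / 2) * ((m.2.1 : ℝ) * (m.2.2 : ℝ)) ^ (-(2 : ℝ) / 3)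

def blk (n M p q r s : ℕ) : Finset ((ℕ × ℕ) × (ℕ × ℕ)) :=
  (Finset.Icc 1 M ×ˢ (Finset.Ioc p q ×ˢ Finset.Ioc r s)).image
    (fun t => ((n - t.1 - t.2.1 - t.2.2, t.1), t.2))

lemma blk_sum (n M p q r s : ℕ) :
    ∑ m ∈ blk n M p q r s, trip m =
      (∑ m ∈ Finset.Icc 1 M, (m : ℝ) ^ (-(1 : ℝ) / 2)) *
      ((∑ m ∈ Finset.Ioc p q, (m : ℝ) ^ (-(2 : ℝ) / 3)) *
       (∑ m ∈ Finset.Ioc r s, (m : ℝ) ^ (-(2 : ℝ) / 3))) := by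
  unfold blk
  rw [Finset.sum_image]
  · rw [Finset.sum_mul_sum, Finset.sum_mul_sum, Finset.sum_product]
    refine Finset.sum_congr rfl fun x _ => ?_
    rw [Finset.sum_product, ]
    simp only [trip, Finset.mul_sum]
    refine Finset.sum_congr rfl fun y _ => Finset.sum_congr rfl fun z _ => ?_
    rw [Real.mul_rpow (by positivity) (by positivity)]
  · rintro ⟨a, b⟩ _ ⟨c, d⟩ _ h
    simp only [Prod.mk.injEq] at h ⊢
    exact ⟨h.1.2, h.2⟩

theorem Jfun_lower_bound :
    ∃ N₀ : ℕ, ∀ N : ℕ, N₀ ≤ N → ∀ n : ℕ,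
      (1 - 1e-4) * (N : ℝ) ≤ (n : ℝ) → n ≤ N →
      Jfun N n > 2.338190371 * (N : ℝ) ^ ((10 : ℝ) / 9) := by
  refine ⟨10 ^ 20, fun N hN n hn hnN => ?_⟩
  have hNr : (10 : ℝ) ^ 20 ≤ N := by exact_mod_cast hN
  have hN0 : (0 : ℝ) < N := lt_of_lt_of_le (by norm_num) hNr
  obtain ⟨X, hX⟩ : ∃ X, X = (N : ℝ) / (16 * (1 + 1e-4)) := ⟨_, rfl⟩
  have hXN : (N : ℝ) = 16.0016 * X := by rw [hX]; ring
  have hX0 : 0 < X := by rw [hX]; positivity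
  obtain ⟨w, hw⟩ : ∃ w, w = X ^ ((1 : ℝ) / 18) := ⟨_, rfl⟩
  have hw0 : 0 < w := by rw [hw]; positivity
  have hw18 : w ^ 18 = X := by
    rw [hw, ← Real.rpow_natCast, ← Real.rpow_mul hX0.le]; norm_num
  have hw10 : 10 ≤ w := by
    by_contra h
    push Not at h
    have : w ^ 18 < 10 ^ 18 := by gcongr
    rw [hw18] at this
    linarith
  have hU : Uconst N = w ^ 6 := by
    unfold Uconst
    rw [← hX, hw, ← Real.rpow_natCast, ← Real.rpow_mul hX0.le]; norm_num
  have hV : Vconst N = w ^ 5 := by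
    unfold Vconst
    rw [hU, ← Real.rpow_natCast, ← Real.rpow_mul hw0.le, ← Real.rpow_natCast]; norm_num
  have hNp : (N : ℝ) ^ ((10 : ℝ) / 9) ≤ 22 * w ^ 20 := by
    rw [hXN, Real.mul_rpow (by norm_num) hX0.le]
    have e : X ^ ((10 : ℝ) / 9) = w ^ 20 := by
      rw [hw, ← Real.rpow_natCast, ← Real.rpow_mul hX0.le]; norm_num
    rw [e]
    gcongr
    have : (22 : ℝ) = (22 ^ 9) ^ ((1 : ℝ) / 9) := by
      rw [← Real.rpow_natCast, ← Real.rpow_mul (by norm_num)]; norm_num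
    rw [this]
    have : (16.0016 : ℝ) ^ ((10 : ℝ) / 9) = (16.0016 ^ 10) ^ ((1 : ℝ) / 9) := by
      rw [← Real.rpow_natCast, ← Real.rpow_mul (by norm_num)]; norm_num
    rw [this]
    exact Real.rpow_le_rpow (by norm_num) (by norm_num) (by norm_num)
  -- the blocks
  obtain ⟨M1, hM1⟩ : ∃ M, M = ⌊(3.5 * w ^ 9) ^ 2⌋₊ := ⟨_, rfl⟩
  obtain ⟨M2, hM2⟩ : ∃ M, M = ⌊(2.8 * w ^ 9) ^ 2⌋₊ := ⟨_, rfl⟩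
  obtain ⟨p, hp⟩ : ∃ M, M = ⌊(w ^ 6) ^ 3⌋₊ := ⟨_, rfl⟩
  obtain ⟨q, hq⟩ : ∃ M, M = ⌊(1.5 * w ^ 6) ^ 3⌋₊ := ⟨_, rfl⟩
  obtain ⟨r, hr⟩ : ∃ M, M = ⌊(2 * w ^ 6) ^ 3⌋₊ := ⟨_, rfl⟩
  obtain ⟨s, hs⟩ : ∃ M, M = ⌊(w ^ 5) ^ 3⌋₊ := ⟨_, rfl⟩
  obtain ⟨t, ht⟩ : ∃ M, M = ⌊(2 * w ^ 5) ^ 3⌋₊ := ⟨_, rfl⟩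
  have fM1 : (M1 : ℝ) ≤ 12.25 * X := by
    rw [hM1]; refine (Nat.floor_le (by positivity)).trans (le_of_eq ?_); rw [← hw18]; ring
  have fM2 : (M2 : ℝ) ≤ 7.84 * X := by
    rw [hM2]; refine (Nat.floor_le (by positivity)).trans (le_of_eq ?_); rw [← hw18]; ring
  have fq : (q : ℝ) ≤ 3.375 * X := by
    rw [hq]; refine (Nat.floor_le (by positivity)).trans (le_of_eq ?_); rw [← hw18]; ring
  have fr : (r : ℝ) ≤ 8 * X := by
    rw [hr]; refine (Nat.floor_le (by positivity)).trans (le_of_eq ?_); rw [← hw18]; ring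
  have ft' : (t : ℝ) ≤ 8 * w ^ 15 := by
    rw [ht]; refine (Nat.floor_le (by positivity)).trans (le_of_eq ?_); ring
  have h15 : w ^ 15 * 1000 ≤ X := by
    rw [← hw18]
    have : (10 : ℝ) ^ 3 ≤ w ^ 3 := by gcongr
    have h := mul_le_mul_of_nonneg_left this (by positivity : 0 ≤ w ^ 15)
    nlinarith
  have hc1 : M1 + q + t + 1 ≤ n := by
    have : (M1 : ℝ) + q + t + 1 ≤ n := by linarith
    exact_mod_cast this
  have hc2 : M2 + r + t + 1 ≤ n := by
    have : (M2 : ℝ) + r + t + 1 ≤ n := by linarith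
    exact_mod_cast this
  have hqr : q ≤ r := by
    rw [hq, hr]; apply Nat.floor_le_floor; gcongr; norm_num
  have hpq : p ≤ q := by
    rw [hp, hq]; apply Nat.floor_le_floor; gcongr; linarith [pow_pos hw0 6]
  have hJ : (∑ m ∈ blk n M1 p q s t, trip m) + (∑ m ∈ blk n M2 q r s t, trip m) ≤ Jfun N n := by
    have hdis : Disjoint (blk n M1 p q s t) (blk n M2 q r s t) := by
      rw [Finset.disjoint_left]
      rintro ⟨⟨a, b⟩, ⟨c, d⟩⟩ h1 h2
      simp only [blk, Finset.mem_image, Finset.mem_product, Finset.mem_Icc, Finset.mem_Ioc,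
        Prod.exists, Prod.mk.injEq] at h1 h2
      omega
    rw [← Finset.sum_union hdis]
    unfold Jfun
    refine Finset.sum_le_sum_of_subset_of_nonneg ?_ (fun m _ _ => by unfold trip; positivity)
    have key : ∀ M p' q' : ℕ, M + q' + t + 1 ≤ n → p ≤ p' → q' ≤ r →
        blk n M p' q' s t ⊆ (((Finset.Icc 1 n ×ˢ Finset.Icc 1 n) ×ˢ (Finset.Icc 1 n ×ˢ Finset.Icc 1 n)).filter
      (fun m => m.1.1 + m.1.2 + m.2.1 + m.2.2 = n ∧ m.1.1 ≤ N ∧ m.1.2 ≤ N ∧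
        Uconst N ^ 3 ≤ (m.2.1 : ℝ) ∧ (m.2.1 : ℝ) ≤ 8 * Uconst N ^ 3 ∧
        Vconst N ^ 3 ≤ (m.2.2 : ℝ) ∧ (m.2.2 : ℝ) ≤ 8 * Vconst N ^ 3)) := by
      intro M p' q' h1 h2 h3 m hm
      simp only [blk, Finset.mem_image, Finset.mem_product, Finset.mem_Icc, Finset.mem_Ioc] at hm
      obtain ⟨⟨x, y, z⟩, hxyz, rfl⟩ := hm
      simp only at hxyz
      simp only [Finset.mem_filter, Finset.mem_product, Finset.mem_Icc]
      refine ⟨by omega, by omega, by omega, by omega, ?_, ?_, ?_, ?_⟩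
      · rw [hU]
        exact (Nat.lt_of_floor_lt (by rw [← hp]; omega : ⌊(w ^ 6) ^ 3⌋₊ < y)).le
      · rw [hU]
        have : y ≤ r := by omega
        have : (y : ℝ) ≤ r := by exact_mod_cast this
        calc (y : ℝ) ≤ 8 * X := this.trans fr
          _ = _ := by rw [← hw18]; ring
      · rw [hV]
        exact (Nat.lt_of_floor_lt (by rw [← hs]; omega : ⌊(w ^ 5) ^ 3⌋₊ < z)).le
      · rw [hV]
        have : z ≤ t := by omega
        have : (z : ℝ) ≤ t := by exact_mod_cast this
        calc (z : ℝ) ≤ 8 * w ^ 15 := this.trans ft'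
          _ = _ := by ring
    exact Finset.union_subset (key _ _ _ hc1 le_rfl hqr) (key _ _ _ hc2 hpq le_rfl)
  rw [blk_sum, blk_sum] at hJ
  have w9 : (10 : ℝ) ^ 9 ≤ w ^ 9 := by gcongr
  have w6 : (10 : ℝ) ^ 6 ≤ w ^ 6 := by gcongr
  have w5 : (10 : ℝ) ^ 5 ≤ w ^ 5 := by gcongr
  have a1 := half_sum' (3.5 * w ^ 9) (by positivity)
  have a2 := half_sum' (2.8 * w ^ 9) (by positivity)
  have b1 := block_sum (w ^ 6) (1.5 * w ^ 6) (by positivity) (by linarith)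
  have b2 := block_sum (1.5 * w ^ 6) (2 * w ^ 6) (by positivity) (by linarith)
  have c1 := block_sum (w ^ 5) (2 * w ^ 5) (by positivity) (by linarith)
  rw [← hM1] at a1
  rw [← hM2] at a2
  rw [← hp, ← hq] at b1
  rw [← hq, ← hr] at b2
  rw [← hs, ← ht] at c1
  replace a1 : 6.99 * w ^ 9 ≤ _ := le_trans (by linarith) a1
  replace a2 : 5.59 * w ^ 9 ≤ _ := le_trans (by linarith) a2
  replace b1 : 1.485 * w ^ 6 ≤ _ := le_trans (by linarith) b1
  replace b2 : 1.485 * w ^ 6 ≤ _ := le_trans (by linarith) b2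
  replace c1 : 2.97 * w ^ 5 ≤ _ := le_trans (by linarith) c1
  have d1 := mul_le_mul a1 (mul_le_mul b1 c1 (by positivity) (by positivity))
    (by positivity) (by positivity)
  have d2 := mul_le_mul a2 (mul_le_mul b2 c1 (by positivity) (by positivity))
    (by positivity) (by positivity)
  have fin1 : 55 * w ^ 20 ≤ Jfun N n := by
    refine le_trans ?_ ((add_le_add d1 d2).trans hJ)
    have : 0 < w ^ 20 := by positivity
    ring_nf
    linarith
  have : 0 < w ^ 20 := by positivity
  have h22 : 2.338190371 * (N : ℝ) ^ ((10 : ℝ) / 9) ≤ 2.338190371 * (22 * w ^ 20) := by gcongr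
  show 2.338190371 * (N : ℝ) ^ ((10 : ℝ) / 9) < Jfun N n
  linarith
end
end

section
/- For every positive integer n, the infinite product ∏_{p prime, p ≥ 17} (1 + A(n,p)) converges, and (1 + A(n,5)) · (1 + A(n,11)) · ∏_{p prime, p ≥ 17} (1 + A(n,p)) ≥ 0.902985. -/
open MeasureTheory Finset
open scoped Classical

noncomputable section

/-- characters with `χ ^ i = 1` -/
def Kset (p i : ℕ) [Fact p.Prime] : Finset (DirichletCharacter ℂ p) :=
  Finset.univ.filter (fun χ => χ ^ i = 1)

/-- size of the Gauss sum -/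
def wt {p : ℕ} (χ : DirichletCharacter ℂ p) : ℝ := if χ = 1 then 1 else Real.sqrt p

lemma wt_nonneg {p : ℕ} (χ : DirichletCharacter ℂ p) : 0 ≤ wt χ := by
  unfold wt; split_ifs <;> positivity

lemma sum_units_eq {p : ℕ} [Fact p.Prime] (χ : DirichletCharacter ℂ p) (f : ZMod p → ℂ) :
    ∑ m : (ZMod p)ˣ, χ m * f m = ∑ x : ZMod p, χ x * f x := by
  symm
  rw [← Finset.sum_subset (s₁ := Finset.univ.image (fun m : (ZMod p)ˣ => (m : ZMod p)))
    (Finset.subset_univ _)]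
  · rw [Finset.sum_image]
    intro a _ b _ h
    exact Units.ext h
  · intro x _ hx
    have : ¬ IsUnit x := by
      rintro ⟨u, rfl⟩
      exact hx (by simp)
    rw [MulChar.map_nonunit χ this, zero_mul]

lemma sum_K {p : ℕ} [Fact p.Prime] (i : ℕ) (x : ZMod p) :
    ∑ χ ∈ Kset p i, χ x = ∑ m : (ZMod p)ˣ, if ((m : ZMod p) ^ i = x) then (1 : ℂ) else 0 := by
  have hφ : ((p.totient : ℕ) : ℂ) ≠ 0 := by
    have := Nat.totient_pos.2 (Fact.out : p.Prime).pos
    exact_mod_cast this.ne'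
  have h1 : ∀ m : (ZMod p)ˣ, ∑ χ : DirichletCharacter ℂ p, χ ((m : ZMod p) ^ i)⁻¹ * χ x
      = if ((m : ZMod p) ^ i = x) then (p.totient : ℂ) else 0 := fun m =>
    DirichletCharacter.sum_char_inv_mul_char_eq ℂ (m.isUnit.pow i) x
  have h2 : ∀ χ : DirichletCharacter ℂ p, ∑ m : (ZMod p)ˣ, χ ((m : ZMod p) ^ i)⁻¹
      = if χ ^ i = 1 then (p.totient : ℂ) else 0 := by
    intro χ
    have h3 : ∀ m : (ZMod p)ˣ, χ ((m : ZMod p) ^ i)⁻¹ = ((χ ^ i)⁻¹ : DirichletCharacter ℂ p) m * 1 := by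
      intro m
      rw [← MulChar.inv_apply', mul_one, ← inv_pow, MulChar.pow_apply_coe, map_pow]
    simp_rw [h3]
    rw [sum_units_eq _ (fun _ => 1)]
    simp only [mul_one]
    split_ifs with h
    · rw [h, inv_one, MulChar.sum_one_eq_card_units, ZMod.card_units_eq_totient]
    · exact MulChar.sum_eq_zero_of_ne_one (by simpa using h)
  have h4 : (p.totient : ℂ) * ∑ χ ∈ Kset p i, χ x = (p.totient : ℂ) *
      ∑ m : (ZMod p)ˣ, if ((m : ZMod p) ^ i = x) then (1 : ℂ) else 0 := by
    calc _ = ∑ χ : DirichletCharacter ℂ p, (if χ ^ i = 1 then (p.totient : ℂ) else 0) * χ x := by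
            rw [Kset, Finset.sum_filter, Finset.mul_sum]
            refine Finset.sum_congr rfl fun χ _ => ?_
            split_ifs <;> simp
      _ = ∑ χ : DirichletCharacter ℂ p, ∑ m : (ZMod p)ˣ, χ ((m : ZMod p) ^ i)⁻¹ * χ x := by
            refine Finset.sum_congr rfl fun χ _ => ?_
            rw [← h2, Finset.sum_mul]
      _ = _ := by
            rw [Finset.sum_comm, Finset.mul_sum]
            refine Finset.sum_congr rfl fun m _ => ?_
            rw [h1]
            split_ifs <;> simp
  exact mul_left_cancel₀ hφ h4

lemma sum_pow_eq {p : ℕ} [Fact p.Prime] (i : ℕ) (ψ : AddChar (ZMod p) ℂ) (a : (ZMod p)ˣ) :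
    ∑ m : (ZMod p)ˣ, ψ (a * (m : ZMod p) ^ i) = ∑ χ ∈ Kset p i, χ⁻¹ a * gaussSum χ ψ := by
  simp_rw [← gaussSum_mulShift_eq, gaussSum]
  rw [Finset.sum_comm]
  simp_rw [← Finset.sum_mul, sum_K, Finset.sum_mul]
  rw [Finset.sum_comm]
  refine Finset.sum_congr rfl fun m _ => ?_
  simp [AddChar.mulShift_apply]

lemma card_K {p : ℕ} [Fact p.Prime] (i : ℕ) :
    (Kset p i).card = (Finset.univ.filter (fun m : (ZMod p)ˣ => m ^ i = 1)).card := by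
  have h := sum_K (p := p) i 1
  simp only [map_one, Finset.sum_const, nsmul_eq_mul, mul_one, Finset.sum_boole] at h
  rw [Nat.cast_inj.1 h]
  congr 1
  ext m
  simp [Units.ext_iff]

lemma card_K_le {p : ℕ} [Fact p.Prime] (i : ℕ) (hi : 0 < i) : (Kset p i).card ≤ i := by
  rw [card_K]
  convert IsCyclic.card_pow_eq_one_le (α := (ZMod p)ˣ) hi using 2

lemma card_K_one {p : ℕ} [Fact p.Prime] (i : ℕ) (hi : Nat.Coprime i (p - 1)) :
    (Kset p i).card ≤ 1 := by
  rw [card_K, Finset.card_le_one]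
  have : ∀ m : (ZMod p)ˣ, m ^ i = 1 → m = 1 := by
    intro m hm
    have h2 : m ^ (p - 1) = 1 := ZMod.units_pow_card_sub_one_eq_one p m
    have := orderOf_dvd_of_pow_eq_one hm
    have h3 := orderOf_dvd_of_pow_eq_one h2
    rw [← orderOf_eq_one_iff]
    exact Nat.eq_one_of_dvd_coprimes hi this h3
  intro a ha b hb
  simp only [Finset.mem_filter, Finset.mem_univ, true_and] at ha hb
  rw [this a ha, this b hb]

lemma norm_gauss_le {p : ℕ} [Fact p.Prime] (χ : DirichletCharacter ℂ p) (ψ : AddChar (ZMod p) ℂ)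
    (hψ : ψ ≠ 1) : ‖gaussSum χ ψ‖ ≤ wt χ := by
  unfold wt
  split_ifs with h
  · rw [h, gaussSum_one_left hψ]; simp
  · have hp : ψ.IsPrimitive := AddChar.IsPrimitive.of_ne_one hψ
    have h1 := gaussSum_mul_gaussSum_eq_card h hp
    rw [← star_gaussSum_eq, ZMod.card] at h1
    have h2 : ‖gaussSum χ ψ‖ ^ 2 = p := by
      have := congrArg norm h1
      rw [norm_mul, norm_star] at this
      rw [sq, this]; simp
    rw [← h2, Real.sqrt_sq (norm_nonneg _)]

lemma sum_wt_le {p : ℕ} [Fact p.Prime] (i t : ℕ) (h : (Kset p i).card ≤ t + 1) :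
    ∑ χ ∈ Kset p i, wt χ ≤ 1 + t * Real.sqrt p := by
  have h1 : (1 : DirichletCharacter ℂ p) ∈ Kset p i := by simp [Kset]
  rw [← Finset.add_sum_erase _ _ h1]
  have h2 : ∑ χ ∈ (Kset p i).erase 1, wt χ = ((Kset p i).erase 1).card * Real.sqrt p := by
    rw [← nsmul_eq_mul, ← Finset.sum_const]
    refine Finset.sum_congr rfl fun χ hχ => ?_
    simp [wt, Finset.ne_of_mem_erase hχ]
  rw [h2, Finset.card_erase_of_mem h1]
  have h3 : (((Kset p i).card - 1 : ℕ) : ℝ) ≤ t := by exact_mod_cast (by omega)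
  have : wt (1 : DirichletCharacter ℂ p) = 1 := by simp [wt]
  rw [this]
  gcongr

lemma sum_wt_sq_le {p : ℕ} [Fact p.Prime] (i t : ℕ) (h : (Kset p i).card ≤ t + 1) :
    ∑ χ ∈ Kset p i, wt χ ^ 2 ≤ 1 + t * p := by
  have h1 : (1 : DirichletCharacter ℂ p) ∈ Kset p i := by simp [Kset]
  rw [← Finset.add_sum_erase _ _ h1]
  have h2 : ∑ χ ∈ (Kset p i).erase 1, wt χ ^ 2 = ((Kset p i).erase 1).card * (p : ℝ) := by
    rw [← nsmul_eq_mul, ← Finset.sum_const]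
    refine Finset.sum_congr rfl fun χ hχ => ?_
    simp [wt, Finset.ne_of_mem_erase hχ]
  rw [h2, Finset.card_erase_of_mem h1]
  have h3 : (((Kset p i).card - 1 : ℕ) : ℝ) ≤ t := by exact_mod_cast (by omega)
  have : wt (1 : DirichletCharacter ℂ p) = 1 := by simp [wt]
  rw [this, one_pow]
  gcongr

/-- expansion of the triple sum -/
lemma triple_eq {p : ℕ} [Fact p.Prime] (ψ : AddChar (ZMod p) ℂ) (c : ZMod p) :
    ∑ a : (ZMod p)ˣ, (∑ m : (ZMod p)ˣ, ψ (a * (m : ZMod p) ^ 2)) *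
      (∑ m : (ZMod p)ˣ, ψ (a * (m : ZMod p) ^ 3)) ^ 2 * ψ (c * a) =
    ∑ χ ∈ Kset p 2, ∑ θ ∈ Kset p 3, ∑ η ∈ Kset p 3,
      gaussSum χ ψ * gaussSum θ ψ * gaussSum η ψ * gaussSum (χ * θ * η)⁻¹ (ψ.mulShift c) := by
  have h : ∀ a : (ZMod p)ˣ, (∑ m : (ZMod p)ˣ, ψ (a * (m : ZMod p) ^ 2)) *
      (∑ m : (ZMod p)ˣ, ψ (a * (m : ZMod p) ^ 3)) ^ 2 * ψ (c * a) =
      ∑ χ ∈ Kset p 2, ∑ θ ∈ Kset p 3, ∑ η ∈ Kset p 3,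
      gaussSum χ ψ * gaussSum θ ψ * gaussSum η ψ * ((χ * θ * η)⁻¹ a * ψ.mulShift c a) := by
    intro a
    simp_rw [sum_pow_eq, sq, Finset.sum_mul_sum, Finset.sum_mul, AddChar.mulShift_apply]
    refine Finset.sum_congr rfl fun χ _ => ?_
    refine Finset.sum_congr rfl fun θ _ => ?_
    rw [Finset.mul_sum, Finset.sum_mul]
    refine Finset.sum_congr rfl fun η _ => ?_
    rw [mul_inv, mul_inv, MulChar.mul_apply, MulChar.mul_apply]
    ring
  simp_rw [h]
  rw [Finset.sum_comm]
  refine Finset.sum_congr rfl fun χ _ => ?_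
  rw [Finset.sum_comm]
  refine Finset.sum_congr rfl fun θ _ => ?_
  rw [Finset.sum_comm]
  refine Finset.sum_congr rfl fun η _ => ?_
  rw [← Finset.mul_sum, sum_units_eq _ (fun x => ψ.mulShift c x)]
  rfl

lemma triple_le {p : ℕ} [Fact p.Prime] (ψ : AddChar (ZMod p) ℂ) (hψ : ψ ≠ 1) (c : ZMod p) (t : ℕ)
    (ht : (Kset p 3).card ≤ t + 1) :
    ‖∑ a : (ZMod p)ˣ, (∑ m : (ZMod p)ˣ, ψ (a * (m : ZMod p) ^ 2)) *
      (∑ m : (ZMod p)ˣ, ψ (a * (m : ZMod p) ^ 3)) ^ 2 * ψ (c * a)‖ ≤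
    Real.sqrt p * (1 + Real.sqrt p) * (1 + t * Real.sqrt p) ^ 2 := by
  have hp1 : (1 : ℝ) ≤ p := by exact_mod_cast (Fact.out : p.Prime).one_le
  have hs1 : (1 : ℝ) ≤ Real.sqrt p := Real.one_le_sqrt.2 hp1
  have hss : Real.sqrt p ^ 2 = p := Real.sq_sqrt (by linarith)
  have hprim : ψ.IsPrimitive := AddChar.IsPrimitive.of_ne_one hψ
  rw [triple_eq]
  have hb : ‖∑ χ ∈ Kset p 2, ∑ θ ∈ Kset p 3, ∑ η ∈ Kset p 3,
      gaussSum χ ψ * gaussSum θ ψ * gaussSum η ψ * gaussSum (χ * θ * η)⁻¹ (ψ.mulShift c)‖ ≤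
      ∑ χ ∈ Kset p 2, ∑ θ ∈ Kset p 3, ∑ η ∈ Kset p 3,
      wt χ * wt θ * wt η * ‖gaussSum (χ * θ * η)⁻¹ (ψ.mulShift c)‖ := by
    refine norm_sum_le_of_le _ fun χ _ => norm_sum_le_of_le _ fun θ _ =>
      norm_sum_le_of_le _ fun η _ => ?_
    rw [norm_mul, norm_mul, norm_mul]
    have := wt_nonneg χ
    have := wt_nonneg θ
    gcongr <;> exact norm_gauss_le _ _ hψ
  refine hb.trans ?_
  have hA := sum_wt_le (p := p) 2 1 (card_K_le 2 (by norm_num))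
  have hB := sum_wt_le (p := p) 3 t ht
  have hA0 : 0 ≤ ∑ χ ∈ Kset p 2, wt χ := Finset.sum_nonneg fun χ _ => wt_nonneg χ
  have hB0 : 0 ≤ ∑ χ ∈ Kset p 3, wt χ := Finset.sum_nonneg fun χ _ => wt_nonneg χ
  by_cases hc : c = 0
  · have h0 : ψ.mulShift c = 1 := by rw [hc]; exact AddChar.mulShift_zero ψ
    rw [h0]
    have key : ∀ χ ∈ Kset p 2, ∀ θ ∈ Kset p 3, ∀ η ∈ Kset p 3,
        wt χ * wt θ * wt η * ‖gaussSum (χ * θ * η)⁻¹ (1 : AddChar (ZMod p) ℂ)‖ ≤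
        if χ = 1 then (if η = θ⁻¹ then wt θ ^ 2 * p else 0) else 0 := by
      intro χ hχ θ hθ η hη
      by_cases h1 : χ * θ * η = 1
      · simp only [Kset, Finset.mem_filter, Finset.mem_univ, true_and] at hχ hθ hη
        have hχ1 : χ = 1 := by
          have h3 : (χ * θ * η) ^ 3 = 1 := by rw [h1, one_pow]
          rw [mul_pow, mul_pow, hθ, hη, pow_succ, hχ] at h3
          simpa using h3
        have hη1 : η = θ⁻¹ := by
          rw [hχ1, one_mul] at h1
          exact eq_inv_of_mul_eq_one_right h1
        rw [if_pos hχ1, if_pos hη1, h1, inv_one, gaussSum_one_one, hχ1, hη1]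
        have hw1 : wt (1 : DirichletCharacter ℂ p) = 1 := by simp [wt]
        have hw2 : wt θ⁻¹ = wt θ := by simp [wt]
        have hcard : ‖((Nat.card (ZMod p)ˣ : ℕ) : ℂ)‖ ≤ p := by
          rw [Nat.card_eq_fintype_card, ZMod.card_units_eq_totient, Complex.norm_natCast]
          exact_mod_cast Nat.totient_le p
        rw [hw1, hw2, one_mul, ← sq]
        gcongr
      · rw [gaussSum_one_right (inv_ne_one.2 h1)]
        simp only [norm_zero, mul_zero]
        split_ifs <;> positivity
    calc _ ≤ ∑ χ ∈ Kset p 2, ∑ θ ∈ Kset p 3, ∑ η ∈ Kset p 3,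
          (if χ = 1 then (if η = θ⁻¹ then wt θ ^ 2 * (p : ℝ) else 0) else 0) :=
          Finset.sum_le_sum fun χ hχ => Finset.sum_le_sum fun θ hθ =>
            Finset.sum_le_sum fun η hη => key χ hχ θ hθ η hη
      _ = ∑ θ ∈ Kset p 3, wt θ ^ 2 * (p : ℝ) := by
          rw [Finset.sum_eq_single_of_mem 1 (by simp [Kset])]
          · refine Finset.sum_congr rfl fun θ hθ => ?_
            have : θ⁻¹ ∈ Kset p 3 := by simpa [Kset] using hθ
            simp [this]
          · intro χ _ h
            simp [h]
      _ ≤ (1 + t * p) * p := by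
          rw [← Finset.sum_mul]
          gcongr
          exact sum_wt_sq_le 3 t ht
      _ ≤ _ := by
          have htt : (t : ℝ) ≤ (t : ℝ) ^ 2 := by exact_mod_cast Nat.le_self_pow (by norm_num) t
          generalize Real.sqrt p = s at *
          rw [← hss]
          have ht0 : (0 : ℝ) ≤ t := by positivity
          have e1 : 1 + (t : ℝ) * s ^ 2 ≤ (1 + t * s) ^ 2 := by
            nlinarith [mul_nonneg ht0 (by linarith : 0 ≤ s), mul_le_mul_of_nonneg_right htt (sq_nonneg s)]
          have e2 : s ^ 2 ≤ s * (1 + s) := by nlinarith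
          calc _ = s ^ 2 * (1 + (t : ℝ) * s ^ 2) := by ring
            _ ≤ _ := by gcongr
  · have hne : ψ.mulShift c ≠ 1 := hprim hc
    calc _ ≤ ∑ χ ∈ Kset p 2, ∑ θ ∈ Kset p 3, ∑ η ∈ Kset p 3,
          wt χ * wt θ * wt η * Real.sqrt p := by
          refine Finset.sum_le_sum fun χ hχ => Finset.sum_le_sum fun θ hθ =>
            Finset.sum_le_sum fun η hη => ?_
          have := wt_nonneg χ
          have := wt_nonneg θ
          have := wt_nonneg η
          have h5 : ‖gaussSum (χ * θ * η)⁻¹ (ψ.mulShift c)‖ ≤ Real.sqrt p := by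
            refine (norm_gauss_le _ _ hne).trans ?_
            unfold wt; split_ifs <;> linarith
          gcongr
      _ = Real.sqrt p * (∑ χ ∈ Kset p 2, wt χ) * (∑ χ ∈ Kset p 3, wt χ) ^ 2 := by
          rw [sq, mul_assoc, Finset.sum_mul_sum, Finset.sum_mul, Finset.mul_sum]
          refine Finset.sum_congr rfl fun χ _ => ?_
          rw [Finset.mul_sum, Finset.mul_sum]
          refine Finset.sum_congr rfl fun θ _ => ?_
          rw [Finset.mul_sum, Finset.mul_sum]
          refine Finset.sum_congr rfl fun η _ => ?_
          ring
      _ ≤ _ := by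
          push_cast at hA
          rw [one_mul] at hA
          gcongr

lemma sum_bridge {p : ℕ} [Fact p.Prime] (F : ZMod p → ℂ) :
    ∑ m ∈ (Finset.Icc 1 p).filter (fun m => Nat.gcd m p = 1), F (m : ZMod p) =
      ∑ u : (ZMod p)ˣ, F u := by
  have hp : p.Prime := Fact.out
  refine Finset.sum_bij (fun m hm => ZMod.unitOfCoprime m (Finset.mem_filter.1 hm).2) ?_ ?_ ?_ ?_
  · intros; exact Finset.mem_univ _
  · intro a ha b hb h
    have h1 : (a : ZMod p) = b := by
      have := congrArg (fun u : (ZMod p)ˣ => (u : ZMod p)) h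
      simpa using this
    rw [ZMod.natCast_eq_natCast_iff'] at h1
    simp only [Finset.mem_filter, Finset.mem_Icc] at ha hb
    have lt : ∀ x : ℕ, x ≤ p → Nat.gcd x p = 1 → x < p := by
      intro x hx hg
      rcases hx.lt_or_eq with h | h
      · exact h
      · rw [h, Nat.gcd_self] at hg
        exact absurd hg hp.one_lt.ne'
    rwa [Nat.mod_eq_of_lt (lt a ha.1.2 ha.2), Nat.mod_eq_of_lt (lt b hb.1.2 hb.2)] at h1
  · intro u _
    have hc : Nat.gcd (u : ZMod p).val p = 1 := ZMod.val_coe_unit_coprime u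
    refine ⟨(u : ZMod p).val, ?_, ?_⟩
    · simp only [Finset.mem_filter, Finset.mem_Icc]
      refine ⟨⟨Nat.pos_of_ne_zero ?_, (ZMod.val_lt _).le⟩, hc⟩
      intro h0
      rw [h0, Nat.gcd_zero_left] at hc
      exact hp.one_lt.ne' hc
    · ext
      simp
  · intro m hm
    simp

lemma eu_eq {p : ℕ} [Fact p.Prime] (x : ℝ) (j : ℤ) (h : x = j) :
    eu (x / p) = ZMod.stdAddChar ((j : ℤ) : ZMod p) := by
  rw [ZMod.stdAddChar_coe, eu, h]
  congr 1
  push_cast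
  ring

lemma Cq_eq {p : ℕ} [Fact p.Prime] (i a : ℕ) :
    Cq i p a = ∑ m : (ZMod p)ˣ, ZMod.stdAddChar ((a : ZMod p) * (m : ZMod p) ^ i) := by
  rw [Cq, ← sum_bridge (fun m => ZMod.stdAddChar ((a : ZMod p) * m ^ i))]
  refine Finset.sum_congr rfl fun m _ => ?_
  rw [eu_eq _ ((a : ℤ) * (m : ℤ) ^ i) (by push_cast; ring)]
  push_cast
  rfl

lemma Afun_bound {p : ℕ} (hp : p.Prime) (n t : ℕ) (ht : ∀ _ : Fact p.Prime, (Kset p 3).card ≤ t + 1) :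
    |Afun n p| ≤ Real.sqrt p * (1 + Real.sqrt p) * (1 + t * Real.sqrt p) ^ 2 / ((p : ℝ) - 1) ^ 4 := by
  haveI : Fact p.Prime := ⟨hp⟩
  have h1 : (ZMod.stdAddChar : AddChar (ZMod p) ℂ) ≠ 1 := by
    have h := ZMod.isPrimitive_stdAddChar p (one_ne_zero)
    intro h2
    apply h
    rw [h2]
    ext; simp
  have h := triple_le (ZMod.stdAddChar : AddChar (ZMod p) ℂ) h1 (-(n : ZMod p)) t (ht _)
  rw [← sum_bridge (fun a => (∑ m : (ZMod p)ˣ, ZMod.stdAddChar (a * (m : ZMod p) ^ 2)) *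
      (∑ m : (ZMod p)ˣ, ZMod.stdAddChar (a * (m : ZMod p) ^ 3)) ^ 2 *
      ZMod.stdAddChar (-(n : ZMod p) * a))] at h
  have h2 : ∀ a : ℕ, eu (-(a * n : ℝ) / p) = ZMod.stdAddChar (-(n : ZMod p) * (a : ZMod p)) := by
    intro a
    rw [eu_eq _ (-((n : ℤ) * a)) (by push_cast; ring)]
    push_cast
    rw [neg_mul]
  unfold Afun
  refine (Complex.abs_re_le_norm _).trans ?_
  rw [norm_mul, norm_div, norm_pow]
  simp_rw [Cq_eq, h2]
  rw [ArithmeticFunction.moebius_apply_prime hp, Nat.totient_prime hp, Nat.cast_sub hp.one_le]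
  have h3 : ‖((p : ℂ) - (1 : ℕ))‖ = (p : ℝ) - 1 := by
    rw [← Nat.cast_sub hp.one_le, Complex.norm_natCast, Nat.cast_sub hp.one_le]
    simp
  rw [h3]
  simp only [Int.cast_neg, Int.cast_one, norm_neg, norm_one]
  rw [div_mul_eq_mul_div, one_mul]
  have : (1 : ℝ) ≤ p := by exact_mod_cast hp.one_le
  gcongr

lemma Afun_bound1 {p : ℕ} (hp : p.Prime) (n : ℕ) :
    |Afun n p| ≤ Real.sqrt p * (1 + Real.sqrt p) * (1 + 2 * Real.sqrt p) ^ 2 / ((p : ℝ) - 1) ^ 4 := by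
  exact_mod_cast Afun_bound hp n 2 (fun _ => card_K_le 3 (by norm_num))

lemma Afun_bound2 {p : ℕ} (hp : p.Prime) (h : p % 3 = 2) (n : ℕ) :
    |Afun n p| ≤ Real.sqrt p * (1 + Real.sqrt p) / ((p : ℝ) - 1) ^ 4 := by
  have := Afun_bound hp n 0 (fun _ => card_K_one 3 (by
    rw [Nat.Prime.coprime_iff_not_dvd Nat.prime_three]
    omega))
  simpa using this

lemma A5 (n : ℕ) : |Afun n 5| ≤ 0.0283 := by
  refine (Afun_bound2 (by norm_num) (by norm_num) n).trans ?_
  have h1 : Real.sqrt ((5 : ℕ) : ℝ) ≤ 2.237 := by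
    rw [Real.sqrt_le_left (by norm_num)]; norm_num
  have h0 := Real.sqrt_nonneg ((5 : ℕ) : ℝ)
  rw [div_le_iff₀ (by norm_num)]
  calc _ ≤ 2.237 * (1 + 2.237 : ℝ) := by gcongr
    _ ≤ _ := by norm_num

lemma A11 (n : ℕ) : |Afun n 11| ≤ 0.0015 := by
  refine (Afun_bound2 (by norm_num) (by norm_num) n).trans ?_
  have h1 : Real.sqrt ((11 : ℕ) : ℝ) ≤ 3.32 := by
    rw [Real.sqrt_le_left (by norm_num)]; norm_num
  have h0 := Real.sqrt_nonneg ((11 : ℕ) : ℝ)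
  rw [div_le_iff₀ (by norm_num)]
  calc _ ≤ 3.32 * (1 + 3.32 : ℝ) := by gcongr
    _ ≤ _ := by norm_num

lemma A19 (n : ℕ) : |Afun n 19| ≤ 0.0212 := by
  refine (Afun_bound1 (by norm_num) n).trans ?_
  have h1 : Real.sqrt ((19 : ℕ) : ℝ) ≤ 4.36 := by
    rw [Real.sqrt_le_left (by norm_num)]; norm_num
  have h0 := Real.sqrt_nonneg ((19 : ℕ) : ℝ)
  rw [div_le_iff₀ (by norm_num)]
  calc _ ≤ 4.36 * (1 + 4.36) * (1 + 2 * 4.36 : ℝ) ^ 2 := by gcongr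
    _ ≤ _ := by norm_num

lemma Abig {p : ℕ} (hp : p.Prime) (h31 : 31 ≤ p) (n : ℕ) : |Afun n p| ≤ 6.5 / (p : ℝ) ^ 2 := by
  refine (Afun_bound1 hp n).trans ?_
  have hp31 : (31 : ℝ) ≤ p := by exact_mod_cast h31
  have h1 : 5.56 ≤ Real.sqrt p := Real.le_sqrt_of_sq_le (by norm_num; linarith)
  have hss : Real.sqrt p ^ 2 = p := Real.sq_sqrt (by linarith)
  rw [div_le_div_iff₀ (by apply pow_pos; linarith) (by positivity)]
  generalize Real.sqrt p = s at *
  rw [← hss]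
  obtain ⟨u, rfl⟩ : ∃ u, s = 5.56 + u := ⟨s - 5.56, by ring⟩
  have hu : 0 ≤ u := by linarith
  rw [← sub_nonneg]
  ring_nf
  positivity

lemma Abig2 {p : ℕ} (hp : p.Prime) (h : p % 3 = 2) (h17 : 17 ≤ p) (n : ℕ) :
    |Afun n p| ≤ 0.1 / (p : ℝ) ^ 2 := by
  refine (Afun_bound2 hp h n).trans ?_
  have hp17 : (17 : ℝ) ≤ p := by exact_mod_cast h17
  have h1 : 4.12 ≤ Real.sqrt p := Real.le_sqrt_of_sq_le (by norm_num; linarith)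
  have hss : Real.sqrt p ^ 2 = p := Real.sq_sqrt (by linarith)
  rw [div_le_div_iff₀ (by apply pow_pos; linarith) (by positivity)]
  generalize Real.sqrt p = s at *
  rw [← hss]
  obtain ⟨u, rfl⟩ : ∃ u, s = 4.12 + u := ⟨s - 4.12, by ring⟩
  have hu : 0 ≤ u := by linarith
  rw [← sub_nonneg]
  ring_nf
  positivity

/-- majorant of `|A(n,p)|` on primes `p ≥ 17` -/
def maj (k : ℕ) : ℝ :=
  if k = 19 then 0.0212
  else if 17 ≤ k ∧ k % 6 = 5 then 0.1 / (k : ℝ) ^ 2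
  else if 31 ≤ k ∧ k % 6 = 1 then 6.5 / (k : ℝ) ^ 2
  else 0

lemma maj_nonneg (k : ℕ) : 0 ≤ maj k := by
  unfold maj; split_ifs <;> positivity

lemma A_le_maj {p : ℕ} (hp : p.Prime) (h17 : 17 ≤ p) (n : ℕ) : |Afun n p| ≤ maj p := by
  unfold maj
  have h2 : p % 2 = 1 := by
    rcases hp.eq_two_or_odd with h | h <;> omega
  have h3 : p % 3 ≠ 0 := by
    intro h
    have := (Nat.prime_dvd_prime_iff_eq Nat.prime_three hp).1 (Nat.dvd_of_mod_eq_zero h)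
    omega
  have h6 : p % 6 = 1 ∨ p % 6 = 5 := by
    have := Nat.mod_lt p (show 6 > 0 by norm_num)
    interval_cases h : p % 6 <;> omega
  have h25 : p ≠ 25 := by rintro rfl; norm_num at hp
  split_ifs with ha hb hc
  · rw [ha]; exact A19 n
  · exact Abig2 hp (by omega) h17 n
  · exact Abig hp hc.1 n
  · exfalso
    rcases h6 with h | h
    · have : p < 31 := by
        by_contra h'
        exact hc ⟨by omega, h⟩
      interval_cases p <;> omega
    · exact hb ⟨h17, h⟩

lemma maj_range (M : ℕ) : ∑ k ∈ Finset.range (6 * (M + 5)), maj k ≤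
    0.0620 - (6.5 / 6) / (6 * M + 28) - (0.1 / 6) / (6 * M + 32) := by
  induction M with
  | zero =>
    simp only [Finset.sum_range_succ, maj, Finset.sum_range_zero]
    norm_num [Finset.sum_range_succ]
  | succ M ih =>
    have e : 6 * (M + 1 + 5) = 6 * (M + 5) + 6 := by ring
    rw [e]
    simp only [Finset.sum_range_succ]
    have m0 : maj (6 * (M + 5)) = 0 := by
      unfold maj; rw [if_neg (by omega), if_neg (by omega), if_neg (by omega)]
    have m1 : maj (6 * (M + 5) + 1) = 6.5 / (6 * M + 31) ^ 2 := by
      unfold maj; rw [if_neg (by omega), if_neg (by omega), if_pos (by omega)]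
      push_cast; ring_nf
    have m2 : maj (6 * (M + 5) + 2) = 0 := by
      unfold maj; rw [if_neg (by omega), if_neg (by omega), if_neg (by omega)]
    have m3 : maj (6 * (M + 5) + 3) = 0 := by
      unfold maj; rw [if_neg (by omega), if_neg (by omega), if_neg (by omega)]
    have m4 : maj (6 * (M + 5) + 4) = 0 := by
      unfold maj; rw [if_neg (by omega), if_neg (by omega), if_neg (by omega)]
    have m5 : maj (6 * (M + 5) + 5) = 0.1 / (6 * M + 35) ^ 2 := by
      unfold maj; rw [if_neg (by omega), if_pos (by omega)]
      push_cast; ring_nf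
    rw [m0, m1, m2, m3, m4, m5]
    have tel : ∀ c x : ℝ, 0 ≤ c → 3 < x → c / x ^ 2 ≤ (c / 6) / (x - 3) - (c / 6) / (x + 3) := by
      intro c x hc hx
      have hx3 : 0 < x - 3 := by linarith
      have hx4 : 0 < x + 3 := by linarith
      have : (c / 6) / (x - 3) - (c / 6) / (x + 3) = c / ((x - 3) * (x + 3)) := by
        field_simp; ring
      rw [this]
      gcongr
      nlinarith
    have hM : (0 : ℝ) ≤ M := by positivity
    have t1 := tel 6.5 (6 * M + 31) (by norm_num) (by linarith)
    have t2 := tel 0.1 (6 * M + 35) (by norm_num) (by linarith)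
    have r1 : (6 * (M : ℝ) + 31 - 3) = 6 * M + 28 := by ring
    have r2 : (6 * (M : ℝ) + 31 + 3) = 6 * M + 34 := by ring
    have r3 : (6 * (M : ℝ) + 35 - 3) = 6 * M + 32 := by ring
    have r4 : (6 * (M : ℝ) + 35 + 3) = 6 * M + 38 := by ring
    have r5 : (6 * ((M + 1 : ℕ) : ℝ) + 28) = 6 * M + 34 := by push_cast; ring
    have r6 : (6 * ((M + 1 : ℕ) : ℝ) + 32) = 6 * M + 38 := by push_cast; ring
    rw [r1, r2] at t1
    rw [r3, r4] at t2
    rw [r5, r6]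
    linarith

lemma maj_finset (s : Finset ℕ) : ∑ k ∈ s, maj k ≤ 0.0620 := by
  have h1 : ∑ k ∈ s, maj k ≤ ∑ k ∈ Finset.range (6 * (s.sup id + 5)), maj k := by
    refine Finset.sum_le_sum_of_subset_of_nonneg ?_ fun k _ _ => maj_nonneg k
    intro k hk
    have : k ≤ s.sup id := Finset.le_sup (f := id) hk
    rw [Finset.mem_range]; omega
  have h2 := maj_range (s.sup id)
  have h3 : (0 : ℝ) ≤ (6.5 / 6) / (6 * (s.sup id : ℕ) + 28) := by positivity
  have h4 : (0 : ℝ) ≤ (0.1 / 6) / (6 * (s.sup id : ℕ) + 32) := by positivity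
  linarith

lemma prod_lower {ι : Type*} (s : Finset ι) (f g : ι → ℝ) (hfg : ∀ i, |f i| ≤ g i)
    (hg : ∀ t : Finset ι, ∑ i ∈ t, g i ≤ 0.0620) :
    1 - ∑ i ∈ s, g i ≤ ∏ i ∈ s, (1 + f i) := by
  induction s using Finset.induction_on with
  | empty => simp
  | insert a s ha ih =>
    have h1 := hg (insert a s)
    rw [Finset.sum_insert ha] at h1 ⊢
    rw [Finset.prod_insert ha]
    have h2 := neg_abs_le (f a)
    have h3 := hfg a
    have h4 : 0 ≤ g a := (abs_nonneg _).trans h3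
    have h5 : 0 ≤ ∑ i ∈ s, g i := Finset.sum_nonneg fun i _ => (abs_nonneg _).trans (hfg i)
    have h6 : (1 - g a) * (1 - ∑ i ∈ s, g i) ≤ (1 + f a) * ∏ i ∈ s, (1 + f i) :=
      mul_le_mul (by linarith) ih (by linarith) (by linarith)
    nlinarith

/-- The product `∏_{p ≥ 17 prime} (1 + A(n,p))` converges and
`(1+A(n,5))(1+A(n,11)) ∏_{p ≥ 17} (1+A(n,p)) ≥ 0.902985`. -/
theorem singular_factor_lower_bound (n : ℕ) (hn : 0 < n) :
    Multipliable (fun p : {p : ℕ // p.Prime ∧ 17 ≤ p} => 1 + Afun n p) ∧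
    (1 + Afun n 5) * (1 + Afun n 11) *
      ∏' p : {p : ℕ // p.Prime ∧ 17 ≤ p}, (1 + Afun n p) ≥ 0.902985 := by
  have hb : ∀ p : {p : ℕ // p.Prime ∧ 17 ≤ p}, |Afun n p| ≤ maj p := fun p =>
    A_le_maj p.2.1 p.2.2 n
  have hs : ∀ t : Finset {p : ℕ // p.Prime ∧ 17 ≤ p}, ∑ i ∈ t, maj i ≤ 0.0620 := by
    intro t
    have := maj_finset (t.map (Function.Embedding.subtype _))
    rw [Finset.sum_map] at this
    exact this
  have hsum : Summable (fun p : {p : ℕ // p.Prime ∧ 17 ≤ p} => maj p) :=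
    summable_of_sum_le (fun p => maj_nonneg p) hs
  have hmul : Multipliable (fun p : {p : ℕ // p.Prime ∧ 17 ≤ p} => 1 + Afun n p) :=
    Real.multipliable_one_add_of_summable (hsum.of_norm_bounded (fun p => by
      rw [Real.norm_eq_abs]; exact hb p))
  refine ⟨hmul, ?_⟩
  have hP : (0.938 : ℝ) ≤ ∏' p : {p : ℕ // p.Prime ∧ 17 ≤ p}, (1 + Afun n p) := by
    refine ge_of_tendsto' hmul.hasProd fun s => ?_
    have := prod_lower s (fun p : {p : ℕ // p.Prime ∧ 17 ≤ p} => Afun n p) (fun p => maj p) hb hs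
    have h2 := hs s
    linarith
  have h5 := (abs_le.1 (A5 n)).1
  have h11 := (abs_le.1 (A11 n)).1
  have h6 : (0.9717 * 0.9985 : ℝ) ≤ (1 + Afun n 5) * (1 + Afun n 11) :=
    mul_le_mul (by linarith) (by linarith) (by norm_num) (by linarith)
  have h7 : (0.9717 * 0.9985 * 0.938 : ℝ) ≤ (1 + Afun n 5) * (1 + Afun n 11) *
      ∏' p : {p : ℕ // p.Prime ∧ 17 ≤ p}, (1 + Afun n p) :=
    mul_le_mul h6 hP (by norm_num) (le_trans (by norm_num) h6)
  refine le_trans (by norm_num) h7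
end
end

section
/- For every integer k ≥ 27 and every real c ≥ 1, there exist a constant C > 0 and N₀ such that for all even integers N₁, N₂ with N₀ ≤ N₂ < N₁ ≤ c·N₂, setting L = log₂ N₁, one has ∑ 𝔖(N₁ − 2^{v₁} − ... − 2^{v_k}) · 𝔖(N₂ − 2^{v₁} − ... − 2^{v_k}) ≥ 3.261435·L^k − C·L^{k−1}, where the sum runs over k-tuples of integers (v₁, ..., v_k) with 1 ≤ v_j ≤ L for each j such that both n₁ = N₁ − 2^{v₁} − ... − 2^{v_k} ≥ 2 and n₂ = N₂ − 2^{v₁} − ... − 2^{v_k} ≥ 2 (note n₁ and n₂ are then automatically even). -/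
open MeasureTheory Finset
open scoped Classical

noncomputable section

/-- exponential sum over units -/
def CZ (i q : ℕ) [NeZero q] (a : ZMod q) : ℂ :=
  ∑ m : (ZMod q)ˣ, ZMod.stdAddChar (a * (m : ZMod q) ^ i)

def TZ (q : ℕ) [NeZero q] (n : ZMod q) : ℂ :=
  ∑ a : (ZMod q)ˣ, CZ 2 q a * CZ 3 q a ^ 2 * ZMod.stdAddChar (-((a : ZMod q) * n))

lemma sum_units_eq_s5 (q : ℕ) [NeZero q] (F : ZMod q → ℂ) :
    ∑ m ∈ (Finset.Icc 1 q).filter (fun m => Nat.gcd m q = 1), F (m : ZMod q)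
      = ∑ u : (ZMod q)ˣ, F u := by
  refine Finset.sum_bij (fun m hm => ZMod.unitOfCoprime m (Finset.mem_filter.1 hm).2) ?_ ?_ ?_ ?_
  · intro a ha; exact Finset.mem_univ _
  · intro a ha b hb hab
    have h1 : ((a : ℕ) : ZMod q) = (b : ZMod q) := by
      have := congrArg (fun u : (ZMod q)ˣ => (u : ZMod q)) hab
      simpa using this
    rw [ZMod.natCast_eq_natCast_iff] at h1
    have ha' := Finset.mem_Icc.1 (Finset.mem_filter.1 ha).1
    have hb' := Finset.mem_Icc.1 (Finset.mem_filter.1 hb).1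
    have h2 := (Nat.modEq_iff_dvd.1 h1)
    obtain ⟨t, ht⟩ := h2
    have hq : (0:ℤ) < q := by have := NeZero.pos q; exact_mod_cast this
    have : t = 0 := by
      have e1 : ((b:ℤ) - a) < q := by omega
      have e2 : -(q:ℤ) < ((b:ℤ) - a) := by omega
      rw [ht] at e1 e2
      have : t < 1 := by nlinarith
      have : -1 < t := by nlinarith
      omega
    rw [this] at ht
    omega
  · intro u _
    by_cases h : (u : ZMod q).val = 0
    · have hq1 : q = 1 := by
        have := ZMod.val_coe_unit_coprime u
        rw [h] at this
        simpa using this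
      subst hq1
      exact ⟨1, by simp, Subsingleton.elim _ _⟩
    · refine ⟨(u : ZMod q).val, ?_, ?_⟩
      · rw [Finset.mem_filter, Finset.mem_Icc]
        exact ⟨⟨Nat.one_le_iff_ne_zero.2 h, (ZMod.val_lt _).le⟩, ZMod.val_coe_unit_coprime u⟩
      · ext; simp
  · intro a ha; simp

lemma eu_int (q : ℕ) [NeZero q] (j : ℤ) (x : ℝ) (hx : x = (j : ℝ) / q) :
    eu x = ZMod.stdAddChar (j : ZMod q) := by
  rw [ZMod.stdAddChar_coe, eu, hx]
  push_cast
  ring_nf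

lemma Cq_eq_s5 (i q : ℕ) [NeZero q] (a : ℕ) : Cq i q a = CZ i q (a : ZMod q) := by
  rw [Cq, CZ, ← sum_units_eq_s5 q (fun m => ZMod.stdAddChar ((a : ZMod q) * m ^ i))]
  refine Finset.sum_congr rfl fun m _ => ?_
  rw [eu_int q ((a * m ^ i : ℕ) : ℤ) _ (by push_cast; rfl)]
  push_cast
  rfl

/-- complex version of `Afun` -/
def Ac (n q : ℕ) : ℂ :=
  ((ArithmeticFunction.moebius q : ℤ) : ℂ) / ((Nat.totient q : ℂ)) ^ 4 *
    ∑ a ∈ (Finset.Icc 1 q).filter (fun a => Nat.gcd a q = 1),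
      Cq 2 q a * (Cq 3 q a) ^ 2 * eu (-(a * n : ℝ) / q)

lemma Afun_eq (n q : ℕ) : Afun n q = (Ac n q).re := rfl

lemma Ac_eq (n q : ℕ) [NeZero q] : Ac n q =
    ((ArithmeticFunction.moebius q : ℤ) : ℂ) / ((Nat.totient q : ℂ)) ^ 4 * TZ q (n : ZMod q) := by
  rw [Ac, TZ, ← sum_units_eq_s5 q (fun a => CZ 2 q a * CZ 3 q a ^ 2 *
    ZMod.stdAddChar (-(a * (n : ZMod q))))]
  congr 1
  refine Finset.sum_congr rfl fun m _ => ?_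
  rw [Cq_eq_s5, Cq_eq_s5, eu_int q (-(m * n : ℕ) : ℤ) _ (by push_cast; rfl)]
  push_cast
  rfl

lemma stdAddChar_mul (m n : ℕ) [NeZero m] [NeZero n] [NeZero (m * n)] (x y : ℤ)
    (h : (m : ℤ) * x + n * y = 1) (j : ℤ) :
    (ZMod.stdAddChar (j : ZMod (m * n)) : ℂ) =
      ZMod.stdAddChar ((y * j : ℤ) : ZMod m) * ZMod.stdAddChar ((x * j : ℤ) : ZMod n) := by
  rw [ZMod.stdAddChar_coe, ZMod.stdAddChar_coe, ZMod.stdAddChar_coe, ← Complex.exp_add]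
  congr 1
  have hm : (m : ℂ) ≠ 0 := by exact_mod_cast NeZero.ne m
  have hn : (n : ℂ) ≠ 0 := by exact_mod_cast NeZero.ne n
  have h' : (m : ℂ) * x + n * y = 1 := by exact_mod_cast h
  push_cast
  field_simp
  linear_combination (-(j:ℂ)) * h'

/-- units CRT -/
def crtU (m n : ℕ) (h : Nat.Coprime m n) : (ZMod (m * n))ˣ ≃* (ZMod m)ˣ × (ZMod n)ˣ :=
  (Units.mapEquiv (ZMod.chineseRemainder h).toMulEquiv).trans MulEquiv.prodUnits

lemma stdAddChar_crt (m n : ℕ) [NeZero m] [NeZero n] [NeZero (m * n)] (h : Nat.Coprime m n) :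
    ∃ (u : (ZMod m)ˣ) (w : (ZMod n)ˣ), ∀ z : ZMod (m * n),
    (ZMod.stdAddChar z : ℂ) = ZMod.stdAddChar ((u : ZMod m) * (ZMod.chineseRemainder h z).1) *
      ZMod.stdAddChar ((w : ZMod n) * (ZMod.chineseRemainder h z).2) := by
  have hb : (m : ℤ) * Nat.gcdA m n + n * Nat.gcdB m n = 1 := by
    have := Nat.gcd_eq_gcd_ab m n
    rw [h] at this
    push_cast at this
    exact this.symm
  have e1 : ((n : ℕ) : ZMod m) * ((Nat.gcdB m n : ℤ) : ZMod m) = 1 := by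
    have := congrArg (Int.cast : ℤ → ZMod m) hb
    push_cast at this
    simpa using this
  have e2 : ((m : ℕ) : ZMod n) * ((Nat.gcdA m n : ℤ) : ZMod n) = 1 := by
    have := congrArg (Int.cast : ℤ → ZMod n) hb
    push_cast at this
    simpa using this
  refine ⟨Units.mk _ _ (by rw [mul_comm]; exact e1) e1,
    Units.mk _ _ (by rw [mul_comm]; exact e2) e2, fun z => ?_⟩
  obtain ⟨j, rfl⟩ := ZMod.intCast_surjective z
  rw [stdAddChar_mul m n _ _ hb j, map_intCast (ZMod.chineseRemainder h)]
  push_cast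
  rfl

lemma CZ_crt (m n : ℕ) [NeZero m] [NeZero n] [NeZero (m * n)] (h : Nat.Coprime m n)
    (u : (ZMod m)ˣ) (w : (ZMod n)ˣ) (huw : ∀ z : ZMod (m * n),
    (ZMod.stdAddChar z : ℂ) = ZMod.stdAddChar ((u : ZMod m) * (ZMod.chineseRemainder h z).1) *
      ZMod.stdAddChar ((w : ZMod n) * (ZMod.chineseRemainder h z).2)) (i : ℕ)
    (a : ZMod (m * n)) :
    CZ i (m * n) a = CZ i m (u * (ZMod.chineseRemainder h a).1) *
      CZ i n (w * (ZMod.chineseRemainder h a).2) := by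
  rw [CZ, CZ, CZ, Finset.sum_mul_sum, ← Fintype.sum_prod_type',
    ← (crtU m n h).toEquiv.sum_comp]
  refine Finset.sum_congr rfl fun x _ => ?_
  rw [huw, map_mul (ZMod.chineseRemainder h), map_pow (ZMod.chineseRemainder h)]
  simp only [Prod.fst_mul, Prod.snd_mul, Prod.pow_fst, Prod.pow_snd, mul_assoc]
  rfl

lemma TZ_crt (m n : ℕ) [NeZero m] [NeZero n] [NeZero (m * n)] (h : Nat.Coprime m n) (N : ℕ) :
    TZ (m * n) N = TZ m N * TZ n N := by
  obtain ⟨u, w, huw⟩ := stdAddChar_crt m n h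
  rw [TZ, TZ, TZ, Finset.sum_mul_sum, ← Fintype.sum_prod_type',
    ← ((Equiv.mulLeft u).prodCongr (Equiv.mulLeft w)).sum_comp,
    ← (crtU m n h).toEquiv.sum_comp]
  refine Finset.sum_congr rfl fun x _ => ?_
  rw [CZ_crt m n h u w huw, CZ_crt m n h u w huw, huw,
    map_neg (ZMod.chineseRemainder h), map_mul (ZMod.chineseRemainder h),
    map_natCast (ZMod.chineseRemainder h)]
  have e : ((Equiv.mulLeft u).prodCongr (Equiv.mulLeft w)) ((crtU m n h).toEquiv x)
    = (u * (crtU m n h x).1, w * (crtU m n h x).2) := rfl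
  rw [e]
  have e1 : (((crtU m n h) x).1 : ZMod m) = (ZMod.chineseRemainder h x).1 := rfl
  have e2 : (((crtU m n h) x).2 : ZMod n) = (ZMod.chineseRemainder h x).2 := rfl
  simp only [Units.val_mul, e1, e2, Prod.fst_mul, Prod.snd_mul, Prod.fst_neg, Prod.snd_neg,
    Prod.fst_natCast, Prod.snd_natCast, mul_neg, ← mul_assoc]
  ring

lemma Ac_zero (n : ℕ) : Ac n 0 = 0 := by simp [Ac]

lemma Ac_one (n : ℕ) : Ac n 1 = 1 := by
  rw [Ac_eq]
  simp [TZ, CZ]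
  have h : ∀ x : ZMod 1, (ZMod.stdAddChar x : ℂ) = 1 := by
    intro x
    have : x = 0 := Subsingleton.elim _ _
    rw [this]; simp
  simp [h]

lemma Ac_mul (N : ℕ) {m n : ℕ} (h : Nat.Coprime m n) : Ac N (m * n) = Ac N m * Ac N n := by
  rcases Nat.eq_zero_or_pos m with rfl | hm
  · simp [Ac_zero]
  rcases Nat.eq_zero_or_pos n with rfl | hn
  · simp [Ac_zero]
  have : NeZero m := ⟨hm.ne'⟩
  have : NeZero n := ⟨hn.ne'⟩
  have : NeZero (m * n) := ⟨(Nat.mul_pos hm hn).ne'⟩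
  rw [Ac_eq, Ac_eq, Ac_eq, TZ_crt m n h, Nat.totient_mul h,
    ArithmeticFunction.isMultiplicative_moebius.map_mul_of_coprime h]
  push_cast
  field_simp

lemma Ac_prime_pow (N : ℕ) {p : ℕ} (hp : p.Prime) (e : ℕ) (he : 2 ≤ e) : Ac N (p ^ e) = 0 := by
  have : ArithmeticFunction.moebius (p ^ e) = 0 := by
    apply ArithmeticFunction.moebius_eq_zero_of_not_squarefree
    intro hs
    have := (Nat.squarefree_pow_iff hp.ne_one (by omega)).1 hs
    omega
  simp [Ac, this]


lemma tsum_prime_pow_aux {R : Type*} [NormedRing R] (f : ℕ → R) (h1 : f 1 = 1) (p : ℕ)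
    (h2 : ∀ e, 2 ≤ e → f (p ^ e) = 0) : HasSum (fun e => f (p ^ e)) (1 + f p) := by
  have h := hasSum_sum_of_ne_finset_zero (L := SummationFilter.unconditional ℕ) (f := fun e => f (p ^ e)) (s := Finset.range 2) (by
    intro e he
    apply h2
    simp at he
    omega)
  simpa [Finset.sum_range_succ, h1] using h

/-- A multiplicative function supported on squarefree numbers is summable
once it is summable on the primes. -/
lemma summable_of_primes (f : ℕ → ℝ) (hf : ∀ n, 0 ≤ f n) (h0 : f 0 = 0) (h1 : f 1 = 1)
    (hmul : ∀ {m n : ℕ}, Nat.Coprime m n → f (m * n) = f m * f n)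
    (h2 : ∀ p : ℕ, p.Prime → ∀ e, 2 ≤ e → f (p ^ e) = 0)
    (g : ℕ → ℝ) (hg : Summable g) (hg0 : ∀ n, 0 ≤ g n)
    (hfg : ∀ p : ℕ, p.Prime → f p ≤ g p) : Summable f := by
  refine summable_of_sum_le (c := Real.exp (∑' n, g n)) hf fun s => ?_
  set N := s.sup id + 1 with hN
  have hps : ∀ {p : ℕ}, p.Prime → Summable (fun n : ℕ ↦ ‖f (p ^ n)‖) := by
    intro p hp
    have := (tsum_prime_pow_aux f h1 p (h2 p hp)).summable
    exact this.norm
  have key := EulerProduct.summable_and_hasSum_smoothNumbers_prod_primesBelow_tsum h1 hmul hps N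
  have hprod : ∏ p ∈ N.primesBelow, ∑' n : ℕ, f (p ^ n) ≤ Real.exp (∑' n, g n) := by
    calc ∏ p ∈ N.primesBelow, ∑' n : ℕ, f (p ^ n)
        = ∏ p ∈ N.primesBelow, (1 + f p) := by
          refine Finset.prod_congr rfl fun p hp => ?_
          exact (tsum_prime_pow_aux f h1 p (h2 p (Nat.prime_of_mem_primesBelow hp))).tsum_eq
      _ ≤ ∏ p ∈ N.primesBelow, Real.exp (g p) := by
          refine Finset.prod_le_prod (fun p _ => by linarith [hf p]) fun p hp => ?_
          have := hfg p (Nat.prime_of_mem_primesBelow hp)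
          have := Real.add_one_le_exp (g p)
          linarith
      _ = Real.exp (∑ p ∈ N.primesBelow, g p) := (Real.exp_sum _ _).symm
      _ ≤ _ := Real.exp_le_exp.2 (hg.sum_le_tsum _ fun n _ => hg0 n)
  refine le_trans ?_ hprod
  rw [← Finset.sum_filter_add_sum_filter_not s (fun n => n ≠ 0)]
  have hz : ∑ x ∈ s with ¬ x ≠ 0, f x = 0 := by
    refine Finset.sum_eq_zero fun x hx => ?_
    have := (Finset.mem_filter.1 hx).2
    push Not at this
    rw [this, h0]
  rw [hz, add_zero]
  have hmem : ∀ x ∈ s.filter (fun n => n ≠ 0), x ∈ N.smoothNumbers := by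
    intro x hx
    have hx' := Finset.mem_filter.1 hx
    refine Nat.mem_smoothNumbers_of_lt (Nat.pos_of_ne_zero hx'.2) ?_
    have := Finset.le_sup (f := id) hx'.1
    simp only [id] at this
    omega
  rw [← Finset.sum_subtype_of_mem f hmem]
  exact sum_le_hasSum _ (fun i _ => hf i) key.2

lemma Ac_summable (n : ℕ) (g : ℕ → ℝ) (hg : Summable g) (hg0 : ∀ n, 0 ≤ g n)
    (h : ∀ p : ℕ, p.Prime → 23 ≤ p → ‖Ac n p‖ ≤ g p) : Summable (fun q => ‖Ac n q‖) := by
  have hfin : Summable (fun q : ℕ => if q < 23 then ‖Ac n q‖ else 0) := by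
    apply summable_of_ne_finset_zero (s := Finset.range 23)
    intro b hb
    simp at hb
    simp [hb]
  refine summable_of_primes (fun q => ‖Ac n q‖) (fun _ => norm_nonneg _) (by simp [Ac_zero])
    (by simp [Ac_one]) ?_ ?_ (fun q => g q + if q < 23 then ‖Ac n q‖ else 0) (hg.add hfin) ?_ ?_
  · intro a b hab
    simp [Ac_mul n hab]
  · intro p hp e he
    simp [Ac_prime_pow n hp e he]
  · intro q
    have := hg0 q
    split_ifs <;> positivity
  · intro p hp
    by_cases hlt : p < 23
    · simp [hlt, hg0]
    · have := h p hp (by omega)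
      simpa [hlt] using this

lemma SSfun_eq (n : ℕ) (hs : Summable (fun q => ‖Ac n q‖)) : SSfun n = (∑' q, Ac n q).re := by
  rw [Complex.re_tsum hs.of_norm, SSfun]
  have : ∀ q : ℕ+, Afun n q = (fun q : ℕ => (Ac n q).re) (q : ℕ) := fun q => rfl
  simp_rw [this]
  refine Function.Injective.tsum_eq (f := fun q : ℕ => (Ac n q).re) PNat.coe_injective ?_
  intro q hq
  have : q ≠ 0 := by
    rintro rfl
    simp [Ac_zero] at hq
  exact ⟨⟨q, Nat.pos_of_ne_zero this⟩, rfl⟩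

lemma SSfun_ge (n : ℕ) (hs : Summable (fun q => ‖Ac n q‖)) (w : ℕ → ℝ)
    (hw : ∀ p : ℕ, p.Prime → 1 + Ac n p = (w p : ℂ)) (K : ℝ) (X₀ : ℕ)
    (hK : ∀ X, X₀ ≤ X → K ≤ ∏ p ∈ Nat.primesBelow X, w p) : K ≤ SSfun n := by
  have ht := EulerProduct.eulerProduct (f := Ac n) (Ac_one n) (fun h => Ac_mul n h) hs (Ac_zero n)
  have hre := (Complex.continuous_re.tendsto _).comp ht
  rw [SSfun_eq n hs]
  refine ge_of_tendsto hre ?_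
  filter_upwards [Filter.eventually_ge_atTop X₀] with X hX
  have : ∏ p ∈ X.primesBelow, ∑' e, Ac n (p ^ e) = ((∏ p ∈ X.primesBelow, w p : ℝ) : ℂ) := by
    push_cast
    refine Finset.prod_congr rfl fun p hp => ?_
    have hp' := Nat.prime_of_mem_primesBelow hp
    rw [(tsum_prime_pow_aux (Ac n) (Ac_one n) p (Ac_prime_pow n hp')).tsum_eq, hw p hp']
  simp only [Function.comp]
  rw [this, Complex.ofReal_re]
  exact hK X hX


section local_part
variable {p : ℕ} [hp : Fact p.Prime]

lemma sum_field_units {M : Type*} [AddCommMonoid M] (f : ZMod p → M) :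
    ∑ x, f x = f 0 + ∑ u : (ZMod p)ˣ, f u := by
  rw [← Finset.add_sum_erase _ _ (Finset.mem_univ (0 : ZMod p))]
  congr 1
  symm
  refine Finset.sum_bij (fun u _ => (u : ZMod p)) ?_ ?_ ?_ ?_
  · intro u _; simp
  · intro a _ b _ h; exact Units.ext h
  · intro b hb
    exact ⟨Units.mk0 b (Finset.ne_of_mem_erase hb), Finset.mem_univ _, rfl⟩
  · intro a _; rfl

lemma card_units_R : (Fintype.card (ZMod p)ˣ : ℝ) = (p : ℝ) - 1 := by
  rw [ZMod.card_units p, Nat.cast_sub hp.out.one_le]; simp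

lemma card_units_C : (Fintype.card (ZMod p)ˣ : ℂ) = (p : ℂ) - 1 := by
  rw [ZMod.card_units p, Nat.cast_sub hp.out.one_le]; simp

lemma orth (b : ZMod p) : ∑ x : ZMod p, (ZMod.stdAddChar (x * b) : ℂ) = if b = 0 then (p : ℂ) else 0 := by
  rw [AddChar.sum_mulShift b (ZMod.isPrimitive_stdAddChar p), ZMod.card]
  push_cast
  rfl

/-- number of solutions of `x^2+y^3+z^3=n` in units -/
def Mp (p : ℕ) [Fact p.Prime] (n : ZMod p) : ℕ :=
  ((Finset.univ : Finset ((ZMod p)ˣ × (ZMod p)ˣ × (ZMod p)ˣ)).filter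
    (fun x => (x.1 : ZMod p) ^ 2 + (x.2.1 : ZMod p) ^ 3 + (x.2.2 : ZMod p) ^ 3 = n)).card

lemma TZ_eq_Mp (n : ZMod p) : TZ p n = p * Mp p n - ((p : ℂ) - 1) ^ 3 := by
  have hexp : ∀ a : ZMod p, CZ 2 p a * CZ 3 p a ^ 2 * ZMod.stdAddChar (-(a * n)) =
      ∑ x : (ZMod p)ˣ × (ZMod p)ˣ × (ZMod p)ˣ, (ZMod.stdAddChar (a *
        ((x.1 : ZMod p) ^ 2 + (x.2.1 : ZMod p) ^ 3 + (x.2.2 : ZMod p) ^ 3 - n)) : ℂ) := by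
    intro a
    rw [Fintype.sum_prod_type, CZ, CZ, pow_two, Finset.sum_mul_sum, Finset.sum_mul, Finset.sum_mul]
    refine Finset.sum_congr rfl fun x _ => ?_
    rw [Fintype.sum_prod_type, Finset.mul_sum, Finset.sum_mul]
    refine Finset.sum_congr rfl fun y _ => ?_
    rw [Finset.mul_sum, Finset.sum_mul]
    refine Finset.sum_congr rfl fun z _ => ?_
    rw [← AddChar.map_add_eq_mul, ← AddChar.map_add_eq_mul, ← AddChar.map_add_eq_mul]
    congr 1
    ring
  have hall : ∑ a : ZMod p, CZ 2 p a * CZ 3 p a ^ 2 * ZMod.stdAddChar (-(a * n)) = p * Mp p n := by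
    simp_rw [hexp]
    rw [Finset.sum_comm]
    simp_rw [orth]
    rw [← Finset.sum_filter, Finset.sum_const, Mp, nsmul_eq_mul, mul_comm]
    simp only [sub_eq_zero]
  rw [sum_field_units] at hall
  have h0 : ∀ i, CZ i p 0 = (p : ℂ) - 1 := by
    intro i
    rw [CZ]
    simp [card_units_C, -ZMod.card_units_eq_totient]
  rw [TZ, ← hall, h0, h0]
  simp
  ring

/-- local factor -/
def lw (p : ℕ) [Fact p.Prime] (n : ZMod p) : ℝ :=
  p * (((p : ℝ) - 1) ^ 3 - Mp p n) / ((p : ℝ) - 1) ^ 4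

lemma Mp_le (n : ZMod p) : Mp p n ≤ (p - 1) ^ 3 := by
  refine (Finset.card_le_univ _).trans ?_
  rw [Fintype.card_prod, Fintype.card_prod, ZMod.card_units p]
  apply le_of_eq; ring

lemma p_pos : (0 : ℝ) < (p : ℝ) - 1 := by
  have : (1 : ℝ) < p := by exact_mod_cast hp.out.one_lt
  linarith

lemma lw_nonneg (n : ZMod p) : 0 ≤ lw p n := by
  have h := Mp_le n
  have h' : (Mp p n : ℝ) ≤ ((p : ℝ) - 1) ^ 3 := by
    have : (Mp p n : ℝ) ≤ (((p - 1) ^ 3 : ℕ) : ℝ) := by exact_mod_cast h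
    rwa [Nat.cast_pow, Nat.cast_sub hp.out.one_le, Nat.cast_one] at this
  have := p_pos (p := p)
  rw [lw]
  apply div_nonneg
  · apply mul_nonneg (by positivity); linarith
  · positivity

lemma Ac_prime (n : ℕ) : Ac n p = - TZ p (n : ZMod p) / ((p : ℂ) - 1) ^ 4 := by
  rw [Ac_eq, ArithmeticFunction.moebius_apply_prime hp.out, Nat.totient_prime hp.out,
    Nat.cast_sub hp.out.one_le]
  push_cast
  ring

lemma one_add_Ac (n : ℕ) : 1 + Ac n p = (lw p (n : ZMod p) : ℂ) := by
  have h : ((p : ℂ) - 1) ≠ 0 := by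
    have := (p_pos (p := p)).ne'
    exact_mod_cast this
  rw [Ac_prime, TZ_eq_Mp, lw]
  push_cast
  field_simp
  ring

lemma lw_ge (n : ℕ) : 1 - ‖Ac n p‖ ≤ lw p (n : ZMod p) := by
  have h := congrArg Complex.re (one_add_Ac (p := p) n)
  rw [Complex.ofReal_re, Complex.add_re, Complex.one_re] at h
  have := Complex.abs_re_le_norm (Ac n p)
  have := neg_abs_le (Ac n p).re
  linarith

lemma norm_Ac (n : ℕ) : ‖Ac n p‖ = ‖TZ p (n : ZMod p)‖ / ((p : ℝ) - 1) ^ 4 := by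
  have : ((p : ℂ) - 1) = (((p : ℝ) - 1 : ℝ) : ℂ) := by push_cast; rfl
  rw [Ac_prime, norm_div, norm_neg, norm_pow, this, Complex.norm_real, Real.norm_eq_abs,
    abs_of_pos p_pos]

lemma card_fiber (i : ℕ) (hi : 0 < i) (c : (ZMod p)ˣ) :
    ((Finset.univ : Finset (ZMod p)ˣ).filter (fun x => x ^ i = c)).card ≤ i := by
  calc _ = (((Finset.univ : Finset (ZMod p)ˣ).filter (fun x => x ^ i = c)).image
        (Units.val : (ZMod p)ˣ → ZMod p)).card := by
        rw [Finset.card_image_of_injective _ Units.val_injective]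
    _ ≤ (Polynomial.nthRoots i (c : ZMod p)).toFinset.card := by
        apply Finset.card_le_card
        intro y hy
        simp only [Finset.mem_image, Finset.mem_filter, Finset.mem_univ, true_and] at hy
        obtain ⟨x, hx, rfl⟩ := hy
        rw [Multiset.mem_toFinset, Polynomial.mem_nthRoots hi, ← hx]
        simp
    _ ≤ _ := (Multiset.toFinset_card_le _).trans (Polynomial.card_nthRoots _ _)

lemma sum_shift_le (i : ℕ) (hi : 0 < i) (a : (ZMod p)ˣ) (f : (ZMod p)ˣ → ℝ) (hf : ∀ x, 0 ≤ f x) :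
    ∑ b, f (a * b ^ i) ≤ i * ∑ c, f c := by
  rw [← Finset.sum_fiberwise Finset.univ (fun b : (ZMod p)ˣ => a * b ^ i), Finset.mul_sum]
  refine Finset.sum_le_sum fun c _ => ?_
  have : ∀ b ∈ (Finset.univ : Finset (ZMod p)ˣ).filter (fun b => a * b ^ i = c),
      f (a * b ^ i) = f c := by
    intro b hb
    rw [(Finset.mem_filter.1 hb).2]
  rw [Finset.sum_congr rfl this, Finset.sum_const, nsmul_eq_mul]
  refine mul_le_mul_of_nonneg_right ?_ (hf c)
  have h := card_fiber i hi (a⁻¹ * c)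
  have e : (Finset.univ : Finset (ZMod p)ˣ).filter (fun b => a * b ^ i = c) =
    (Finset.univ : Finset (ZMod p)ˣ).filter (fun b => b ^ i = a⁻¹ * c) := by
    ext b
    simp [eq_inv_mul_iff_mul_eq]
  rw [e]
  exact_mod_cast h

lemma CZ_shift (i : ℕ) (a : ZMod p) (b : (ZMod p)ˣ) : CZ i p (a * (b : ZMod p) ^ i) = CZ i p a := by
  rw [CZ, CZ, ← Equiv.sum_comp (Equiv.mulLeft b) (fun m : (ZMod p)ˣ => (ZMod.stdAddChar (a * (m : ZMod p) ^ i) : ℂ))]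
  refine Finset.sum_congr rfl fun m _ => ?_
  simp only [Equiv.coe_mulLeft, Units.val_mul, mul_pow]
  ring_nf

lemma conj_std (x : ZMod p) : (starRingEnd ℂ) (ZMod.stdAddChar x) = ZMod.stdAddChar (-x) := by
  rw [AddChar.map_neg_eq_conj]

lemma CZ_L2 (i : ℕ) (hi : 0 < i) :
    ∑ a : (ZMod p)ˣ, ‖CZ i p a‖ ^ 2 ≤ ((p : ℝ) - 1) * (((i : ℝ) - 1) * p + 1) := by
  have hexp : ∀ a : ZMod p, ((‖CZ i p a‖ ^ 2 : ℝ) : ℂ) =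
      ∑ x : (ZMod p)ˣ × (ZMod p)ˣ, (ZMod.stdAddChar (a *
        ((x.2 : ZMod p) ^ i - (x.1 : ZMod p) ^ i)) : ℂ) := by
    intro a
    push_cast
    rw [← Complex.conj_mul', CZ, map_sum, Finset.sum_mul_sum, Fintype.sum_prod_type]
    refine Finset.sum_congr rfl fun x _ => Finset.sum_congr rfl fun y _ => ?_
    rw [conj_std, ← AddChar.map_add_eq_mul]
    congr 1
    ring
  set S := (Finset.univ : Finset ((ZMod p)ˣ × (ZMod p)ˣ)).filter (fun x => x.2 ^ i = x.1 ^ i)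
  have hall : ∑ a : ZMod p, ‖CZ i p a‖ ^ 2 = (p : ℝ) * S.card := by
    have : ((∑ a : ZMod p, ‖CZ i p a‖ ^ 2 : ℝ) : ℂ) = (p : ℂ) * S.card := by
      rw [Complex.ofReal_sum]
      simp_rw [hexp]
      rw [Finset.sum_comm]
      simp_rw [orth]
      rw [← Finset.sum_filter, Finset.sum_const, nsmul_eq_mul, mul_comm]
      congr 3
      ext x
      simp only [S, Finset.mem_filter, Finset.mem_univ, true_and, sub_eq_zero]
      rw [← Units.val_pow_eq_pow_val, ← Units.val_pow_eq_pow_val, Units.val_inj]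
    exact_mod_cast this
  have hS : (S.card : ℝ) ≤ i * ((p : ℝ) - 1) := by
    have : S.card ≤ i * Fintype.card (ZMod p)ˣ := by
      rw [mul_comm, ← Finset.card_univ]
      refine (Finset.card_le_mul_card_image_of_maps_to (f := Prod.fst) (t := Finset.univ)
        (by simp) i ?_).trans (by rw [mul_comm])
      intro y _
      refine le_trans ?_ (card_fiber i hi (y ^ i))
      refine Finset.card_le_card_of_injOn Prod.snd ?_ ?_
      · intro x hx
        simp only [S, Finset.coe_filter, Finset.mem_filter, Finset.mem_univ, true_and,
          Set.mem_ofPred_eq] at hx ⊢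
        rw [hx.1, hx.2]
      · intro x hx x' hx' h
        simp only [S, Finset.coe_filter, Finset.mem_filter, Finset.mem_univ, true_and,
          Set.mem_ofPred_eq] at hx hx'
        exact Prod.ext (hx.2.trans hx'.2.symm) h
    have h2 : (S.card : ℝ) ≤ i * (Fintype.card (ZMod p)ˣ : ℝ) := by exact_mod_cast this
    rwa [card_units_R] at h2
  rw [sum_field_units] at hall
  have h0 : ‖CZ i p 0‖ = (p : ℝ) - 1 := by
    rw [CZ]
    simp only [zero_mul, AddChar.map_zero_eq_one, Finset.sum_const, Finset.card_univ]
    rw [nsmul_eq_mul, mul_one, Complex.norm_natCast, card_units_R]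
  rw [h0] at hall
  have hp0 : (0:ℝ) ≤ p := by positivity
  nlinarith [mul_le_mul_of_nonneg_left hS hp0]

lemma CZ3_sup (a : (ZMod p)ˣ) : ‖CZ 3 p a‖ ^ 2 ≤ 3 * (2 * (p : ℝ) + 1) := by
  have h1 := sum_shift_le 3 (by norm_num) a (fun x => ‖CZ 3 p x‖ ^ 2) (fun x => by positivity)
  have h2 := CZ_L2 (p := p) 3 (by norm_num)
  simp only [Units.val_mul, Units.val_pow_eq_pow_val, CZ_shift, Finset.sum_const,
    Finset.card_univ, nsmul_eq_mul, card_units_R] at h1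
  have h3 := p_pos (p := p)
  push_cast at h1 h2
  have : ((p:ℝ) - 1) * ‖CZ 3 p a‖ ^ 2 ≤ ((p:ℝ) - 1) * (3 * (2 * (p : ℝ) + 1)) := by
    nlinarith
  exact le_of_mul_le_mul_left this h3

lemma CZ2_sup (h2 : p ≠ 2) (a : (ZMod p)ˣ) : ‖CZ 2 p a‖ ≤ Real.sqrt p + 1 := by
  set S : ℂ := ∑ x : ZMod p, ZMod.stdAddChar ((a : ZMod p) * x ^ 2) with hS
  have hSC : S = 1 + CZ 2 p a := by
    rw [hS, sum_field_units, CZ]; simp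
  have htwo : (2 : ZMod p) ≠ 0 := by
    intro h
    have : ((2 : ℕ) : ZMod p) = 0 := by exact_mod_cast h
    rw [ZMod.natCast_eq_zero_iff] at this
    exact h2 ((Nat.prime_dvd_prime_iff_eq hp.out Nat.prime_two).1 this)
  have hsq : ((‖S‖ ^ 2 : ℝ) : ℂ) = p := by
    push_cast
    rw [← Complex.conj_mul', hS, map_sum, Finset.sum_mul_sum]
    have e1 : ∀ x : ZMod p, ∑ y : ZMod p, (starRingEnd ℂ) (ZMod.stdAddChar ((a : ZMod p) * x ^ 2)) *
        (ZMod.stdAddChar ((a : ZMod p) * y ^ 2) : ℂ) =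
        ∑ d : ZMod p, (ZMod.stdAddChar (x * (2 * (a : ZMod p) * d)) : ℂ) * ZMod.stdAddChar ((a : ZMod p) * d ^ 2) := by
      intro x
      rw [← Equiv.sum_comp (Equiv.addLeft x)]
      refine Finset.sum_congr rfl fun d _ => ?_
      rw [conj_std, ← AddChar.map_add_eq_mul, ← AddChar.map_add_eq_mul]
      congr 1
      simp only [Equiv.coe_addLeft]
      ring
    rw [Finset.sum_congr rfl fun x _ => e1 x, Finset.sum_comm]
    simp_rw [← Finset.sum_mul, orth]
    rw [Finset.sum_eq_single 0]
    · simp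
    · intro d _ hd
      have : 2 * (a : ZMod p) * d ≠ 0 := mul_ne_zero (mul_ne_zero htwo a.ne_zero) hd
      simp [this]
    · simp
  have hsq' : ‖S‖ ^ 2 = p := by exact_mod_cast hsq
  have hn : ‖S‖ = Real.sqrt p := by
    rw [← hsq', Real.sqrt_sq (norm_nonneg _)]
  have : CZ 2 p a = S - 1 := by rw [hSC]; ring
  rw [this]
  calc ‖S - 1‖ ≤ ‖S‖ + ‖(1:ℂ)‖ := norm_sub_le _ _
    _ = _ := by rw [hn, norm_one]

lemma std_norm (x : ZMod p) : ‖(ZMod.stdAddChar x : ℂ)‖ = 1 := AddChar.norm_apply _ _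

lemma sum_units_std (c : ZMod p) (hc : c ≠ 0) :
    ∑ u : (ZMod p)ˣ, (ZMod.stdAddChar ((u : ZMod p) * c) : ℂ) = -1 := by
  have := orth c
  rw [sum_field_units] at this
  simp [hc] at this
  linear_combination this

/-- case `p ≡ 2 mod 3` -/
lemma TZ_bound_two (h2 : p ≠ 2) (h3 : Nat.Coprime (p - 1) 3) (n : ZMod p) :
    ‖TZ p n‖ ≤ ((p : ℝ) - 1) * (Real.sqrt p + 1) := by
  have hC3 : ∀ a : (ZMod p)ˣ, CZ 3 p a = -1 := by
    intro a
    have hcard : (Nat.card (ZMod p)ˣ).Coprime 3 := by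
      rw [Nat.card_eq_fintype_card, ZMod.card_units p]; exact h3
    rw [← sum_units_std (a : ZMod p) a.ne_zero, CZ,
      ← (powCoprime hcard).sum_comp (fun u : (ZMod p)ˣ => (ZMod.stdAddChar ((u : ZMod p) * (a : ZMod p)) : ℂ))]
    refine Finset.sum_congr rfl fun m _ => ?_
    simp [mul_comm]
  rw [TZ]
  refine (norm_sum_le _ _).trans ?_
  rw [← card_units_R, ← nsmul_eq_mul, ← Finset.card_univ]
  refine Finset.sum_le_card_nsmul _ _ _ fun a _ => ?_
  rw [hC3, norm_mul, std_norm, norm_mul]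
  simpa using CZ2_sup h2 a

lemma TZ_bound_zero : ‖TZ p 0‖ ≤ ((p : ℝ) - 1) * (2 * p + 1) := by
  have hshift : ∀ b : (ZMod p)ˣ, TZ p 0 = ∑ a : (ZMod p)ˣ,
      CZ 2 p ((a : ZMod p) * (b : ZMod p) ^ 3) * CZ 3 p a ^ 2 := by
    intro b
    rw [TZ, ← Equiv.sum_comp (Equiv.mulRight (b ^ 3))]
    refine Finset.sum_congr rfl fun a _ => ?_
    simp [CZ_shift]
  have hC : ∀ a : (ZMod p)ˣ, ∑ b : (ZMod p)ˣ, CZ 2 p ((a : ZMod p) * (b : ZMod p) ^ 3)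
      = - ((p : ℂ) - 1) := by
    intro a
    have e : ∀ b : (ZMod p)ˣ, CZ 2 p ((a : ZMod p) * (b : ZMod p) ^ 3) =
        ∑ m : (ZMod p)ˣ, (ZMod.stdAddChar ((b : ZMod p) * ((a : ZMod p) * (m : ZMod p) ^ 2)) : ℂ) := by
      intro b
      rw [show (a : ZMod p) * (b : ZMod p) ^ 3 = (a * b : ZMod p) * (b : ZMod p) ^ 2 by ring,
        CZ_shift, CZ]
      refine Finset.sum_congr rfl fun m _ => ?_
      congr 1; ring
    simp_rw [e]
    rw [Finset.sum_comm]
    have e2 : ∀ m : (ZMod p)ˣ, ∑ b : (ZMod p)ˣ,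
        (ZMod.stdAddChar ((b : ZMod p) * ((a : ZMod p) * (m : ZMod p) ^ 2)) : ℂ) = -1 := fun m =>
      sum_units_std _ (mul_ne_zero a.ne_zero (pow_ne_zero _ m.ne_zero))
    simp_rw [e2]
    rw [Finset.sum_const, Finset.card_univ, nsmul_eq_mul, card_units_C]; ring
  have hp1 : ((p : ℂ) - 1) ≠ 0 := by
    have := (p_pos (p := p)).ne'
    exact_mod_cast this
  have hT : TZ p 0 = - ∑ a : (ZMod p)ˣ, CZ 3 p a ^ 2 := by
    have h1 : ∑ b : (ZMod p)ˣ, TZ p 0 = ∑ b : (ZMod p)ˣ, ∑ a : (ZMod p)ˣ,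
      CZ 2 p ((a : ZMod p) * (b : ZMod p) ^ 3) * CZ 3 p a ^ 2 :=
      Finset.sum_congr rfl fun b _ => hshift b
    rw [Finset.sum_const, Finset.card_univ, nsmul_eq_mul, card_units_C, Finset.sum_comm] at h1
    simp_rw [← Finset.sum_mul, hC] at h1
    rw [← Finset.mul_sum] at h1
    apply mul_left_cancel₀ hp1
    rw [h1]; ring
  rw [hT, norm_neg]
  refine (norm_sum_le _ _).trans ?_
  simp_rw [norm_pow]
  have := CZ_L2 (p := p) 3 (by norm_num)
  push_cast at this
  linarith

lemma TZ_bound_ne (h2 : p ≠ 2) (n : ZMod p) (hn : n ≠ 0) :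
    ‖TZ p n‖ ≤ (Real.sqrt p + 1) * ((2 * p + 1) * Real.sqrt (15 * p + 3)) := by
  have hshift : ∀ b : (ZMod p)ˣ, TZ p n = ∑ a : (ZMod p)ˣ,
      CZ 2 p a * CZ 3 p a ^ 2 * ZMod.stdAddChar ((-(a : ZMod p) * n) * (b : ZMod p) ^ 6) := by
    intro b
    rw [TZ, ← Equiv.sum_comp (Equiv.mulRight (b ^ 6))]
    refine Finset.sum_congr rfl fun a _ => ?_
    simp only [Equiv.coe_mulRight, Units.val_mul, Units.val_pow_eq_pow_val]
    rw [show (a : ZMod p) * (b : ZMod p) ^ 6 = a * ((b ^ 2 : (ZMod p)ˣ) : ZMod p) ^ 3 by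
      rw [Units.val_pow_eq_pow_val]; ring, CZ_shift]
    rw [show (a : ZMod p) * ((b ^ 2 : (ZMod p)ˣ) : ZMod p) ^ 3
      = a * ((b ^ 3 : (ZMod p)ˣ) : ZMod p) ^ 2 by
      rw [Units.val_pow_eq_pow_val, Units.val_pow_eq_pow_val]; ring, CZ_shift]
    congr 2
    rw [Units.val_pow_eq_pow_val]; ring
  have hT : ((p : ℂ) - 1) * TZ p n = ∑ a : (ZMod p)ˣ,
      CZ 2 p a * CZ 3 p a ^ 2 * CZ 6 p (-(a : ZMod p) * n) := by
    have h1 : ∑ b : (ZMod p)ˣ, TZ p n = ∑ b : (ZMod p)ˣ, ∑ a : (ZMod p)ˣ,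
      CZ 2 p a * CZ 3 p a ^ 2 * ZMod.stdAddChar ((-(a : ZMod p) * n) * (b : ZMod p) ^ 6) :=
      Finset.sum_congr rfl fun b _ => hshift b
    rw [Finset.sum_const, Finset.card_univ, nsmul_eq_mul, card_units_C, Finset.sum_comm] at h1
    rw [h1]
    refine Finset.sum_congr rfl fun a _ => ?_
    rw [← Finset.mul_sum, CZ.eq_def 6]
  have hpp := p_pos (p := p)
  have hnorm : ((p : ℝ) - 1) * ‖TZ p n‖ ≤ (Real.sqrt p + 1) *
      ∑ a : (ZMod p)ˣ, ‖CZ 3 p a‖ ^ 2 * ‖CZ 6 p (-(a : ZMod p) * n)‖ := by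
    have e : ((p : ℝ) - 1) * ‖TZ p n‖ = ‖((p : ℂ) - 1) * TZ p n‖ := by
      have : ((p : ℂ) - 1) = (((p : ℝ) - 1 : ℝ) : ℂ) := by push_cast; rfl
      rw [norm_mul, this, Complex.norm_real, Real.norm_eq_abs, abs_of_pos hpp]
    rw [e, hT, Finset.mul_sum]
    refine (norm_sum_le _ _).trans (Finset.sum_le_sum fun a _ => ?_)
    rw [norm_mul, norm_mul, norm_pow, mul_assoc]
    exact mul_le_mul_of_nonneg_right (CZ2_sup h2 a) (by positivity)
  have h6 : ∑ a : (ZMod p)ˣ, ‖CZ 6 p (-(a : ZMod p) * n)‖ ^ 2 ≤ ((p : ℝ) - 1) * (5 * p + 1) := by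
    have h := CZ_L2 (p := p) 6 (by norm_num)
    rw [← Equiv.sum_comp (Equiv.mulRight (- Units.mk0 n hn))] at h
    simp only [Equiv.coe_mulRight, Units.val_mul, Units.val_neg, Units.val_mk0] at h
    push_cast at h
    refine le_trans (le_of_eq ?_) (h.trans (le_of_eq (by ring)))
    refine Finset.sum_congr rfl fun a _ => ?_
    congr 3; ring
  have h4 : ∑ a : (ZMod p)ˣ, (‖CZ 3 p a‖ ^ 2) ^ 2 ≤
      3 * (2 * p + 1) * (((p : ℝ) - 1) * (2 * p + 1)) := by
    have h := CZ_L2 (p := p) 3 (by norm_num)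
    push_cast at h
    calc _ ≤ ∑ a : (ZMod p)ˣ, 3 * (2 * (p : ℝ) + 1) * ‖CZ 3 p a‖ ^ 2 := by
          refine Finset.sum_le_sum fun a _ => ?_
          rw [pow_two (‖CZ 3 p a‖ ^ 2)]
          exact mul_le_mul_of_nonneg_right (CZ3_sup a) (by positivity)
      _ ≤ _ := by
          rw [← Finset.mul_sum]
          refine mul_le_mul_of_nonneg_left ?_ (by positivity)
          linarith
  have hCS := Finset.sum_mul_sq_le_sq_mul_sq (Finset.univ : Finset (ZMod p)ˣ)
    (fun a => ‖CZ 3 p a‖ ^ 2) (fun a => ‖CZ 6 p (-(a : ZMod p) * n)‖)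
  set Q := ∑ a : (ZMod p)ˣ, ‖CZ 3 p a‖ ^ 2 * ‖CZ 6 p (-(a : ZMod p) * n)‖
  have hQ : Q ≤ ((p : ℝ) - 1) * ((2 * p + 1) * Real.sqrt (15 * p + 3)) := by
    apply le_of_sq_le_sq _ (by positivity)
    refine hCS.trans ?_
    calc _ ≤ (3 * (2 * p + 1) * (((p : ℝ) - 1) * (2 * p + 1))) * (((p : ℝ) - 1) * (5 * p + 1)) := by
          apply mul_le_mul h4 h6 (Finset.sum_nonneg fun _ _ => by positivity) (by positivity)
      _ = _ := by
          rw [mul_pow, mul_pow, Real.sq_sqrt (by positivity)]; ring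
  have : ((p : ℝ) - 1) * ‖TZ p n‖ ≤ ((p : ℝ) - 1) *
      ((Real.sqrt p + 1) * ((2 * p + 1) * Real.sqrt (15 * p + 3))) := by
    refine hnorm.trans ?_
    calc _ ≤ (Real.sqrt p + 1) * (((p : ℝ) - 1) * ((2 * p + 1) * Real.sqrt (15 * p + 3))) :=
          mul_le_mul_of_nonneg_left hQ (by positivity)
      _ = _ := by ring
  exact le_of_mul_le_mul_left this hpp

end local_part


/-- Explicit majorant of `‖Ac n p‖` for primes `p ≥ 23`. -/
def bnd (m : ℕ) : ℝ :=
  if m < 23 ∨ m = 25 then 0 else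
  if m % 6 = 1 then 10.8 / ((m : ℝ) ^ 2 - 9) else
  if m % 6 = 5 then 0.3 / ((m : ℝ) ^ 2 - 9) else 0

lemma bnd_nonneg (m : ℕ) : 0 ≤ bnd m := by
  unfold bnd
  split_ifs with h
  · rfl
  all_goals try rfl
  all_goals
    push Not at h
    have : (23 : ℝ) ≤ m := by exact_mod_cast h.1
    have : 0 < (m : ℝ) ^ 2 - 9 := by nlinarith
    positivity

lemma bnd_block (J : ℕ) : ∑ m ∈ Finset.Ico 23 (29 + 6 * J), bnd m ≤
    0.05 * (1 / 20 - 1 / (26 + 6 * (J : ℝ))) + 1.8 * (1 / 28 - 1 / (28 + 6 * (J : ℝ))) := by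
  induction J with
  | zero =>
    have h24 : bnd 24 = 0 := by simp [bnd]
    have h25 : bnd 25 = 0 := by simp [bnd]
    have h26 : bnd 26 = 0 := by simp [bnd]
    have h27 : bnd 27 = 0 := by simp [bnd]
    have h28 : bnd 28 = 0 := by simp [bnd]
    have h23 : bnd 23 = 0.3 / 520 := by norm_num [bnd]
    have : Finset.Ico 23 (29 + 6 * 0) = {23, 24, 25, 26, 27, 28} := by decide
    rw [this]
    simp [h23, h24, h25, h26, h27, h28]
    norm_num
  | succ J ih =>
    have e : 29 + 6 * (J + 1) = 29 + 6 * J + 1 + 1 + 1 + 1 + 1 + 1 := by ring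
    rw [e]
    iterate 6 rw [Finset.sum_Ico_succ_top (by omega)]
    have h0 : bnd (29 + 6 * J) = 0.3 / ((29 + 6 * (J : ℝ)) ^ 2 - 9) := by
      unfold bnd
      rw [if_neg (by omega), if_neg (by omega), if_pos (by omega)]
      push_cast; rfl
    have h1 : bnd (29 + 6 * J + 1) = 0 := by
      unfold bnd
      rw [if_neg (by omega), if_neg (by omega), if_neg (by omega)]
    have h2 : bnd (29 + 6 * J + 1 + 1) = 10.8 / ((31 + 6 * (J : ℝ)) ^ 2 - 9) := by
      unfold bnd
      rw [if_neg (by omega), if_pos (by omega)]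
      push_cast; ring
    have h3 : bnd (29 + 6 * J + 1 + 1 + 1) = 0 := by
      unfold bnd
      rw [if_neg (by omega), if_neg (by omega), if_neg (by omega)]
    have h4 : bnd (29 + 6 * J + 1 + 1 + 1 + 1) = 0 := by
      unfold bnd
      rw [if_neg (by omega), if_neg (by omega), if_neg (by omega)]
    have h5 : bnd (29 + 6 * J + 1 + 1 + 1 + 1 + 1) = 0 := by
      unfold bnd
      rw [if_neg (by omega), if_neg (by omega), if_neg (by omega)]
    rw [h0, h1, h2, h3, h4, h5]
    have hJ : (0 : ℝ) ≤ J := by positivity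
    have e1 : 0.3 / ((29 + 6 * (J : ℝ)) ^ 2 - 9) =
        0.05 * (1 / (26 + 6 * (J : ℝ)) - 1 / (26 + 6 * ((J : ℝ) + 1))) := by
      have : (29 + 6 * (J : ℝ)) ^ 2 - 9 = (26 + 6 * (J : ℝ)) * (26 + 6 * ((J : ℝ) + 1)) := by ring
      rw [this, div_sub_div _ _ (by positivity) (by positivity)]
      ring
    have e2 : 10.8 / ((31 + 6 * (J : ℝ)) ^ 2 - 9) =
        1.8 * (1 / (28 + 6 * (J : ℝ)) - 1 / (28 + 6 * ((J : ℝ) + 1))) := by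
      have : (31 + 6 * (J : ℝ)) ^ 2 - 9 = (28 + 6 * (J : ℝ)) * (28 + 6 * ((J : ℝ) + 1)) := by ring
      rw [this, div_sub_div _ _ (by positivity) (by positivity)]
      ring
    rw [e1, e2]
    push_cast
    linarith

lemma bnd_sum_le (s : Finset ℕ) : ∑ m ∈ s, bnd m ≤ 0.0668 := by
  set J := s.sup id
  have h1 : ∑ m ∈ s, bnd m ≤ ∑ m ∈ Finset.Ico 23 (29 + 6 * J), bnd m := by
    have hs : ∑ m ∈ s, bnd m = ∑ m ∈ s.filter (fun m => 23 ≤ m), bnd m := by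
      rw [Finset.sum_filter]
      refine Finset.sum_congr rfl fun m _ => ?_
      split_ifs with h
      · rfl
      · unfold bnd
        rw [if_pos (by omega)]
    rw [hs]
    refine Finset.sum_le_sum_of_subset_of_nonneg ?_ fun m _ _ => bnd_nonneg m
    intro m hm
    rw [Finset.mem_filter] at hm
    have := Finset.le_sup (f := id) hm.1
    simp only [id] at this
    rw [Finset.mem_Ico]
    have : m ≤ J := this
    omega
  have h2 := bnd_block J
  have h3 : 0 ≤ 1 / (26 + 6 * (J : ℝ)) := by positivity
  have h4 : 0 ≤ 1 / (28 + 6 * (J : ℝ)) := by positivity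
  linarith

lemma bnd_summable : Summable bnd := summable_of_sum_le bnd_nonneg bnd_sum_le

lemma Ac_bnd (n p : ℕ) (hp : p.Prime) (h23 : 23 ≤ p) : ‖Ac n p‖ ≤ bnd p := by
  have : Fact p.Prime := ⟨hp⟩
  have hP : (23 : ℝ) ≤ p := by exact_mod_cast h23
  have hm : p % 6 = 1 ∨ p % 6 = 5 := by
    have h2 : ¬ 2 ∣ p := fun h => by
      have := (Nat.prime_dvd_prime_iff_eq Nat.prime_two hp).1 h; omega
    have h3 : ¬ 3 ∣ p := fun h => by
      have := (Nat.prime_dvd_prime_iff_eq Nat.prime_three hp).1 h; omega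
    omega
  have h25 : p ≠ 25 := by rintro rfl; revert hp; norm_num
  rw [norm_Ac]
  set s := Real.sqrt p with hs
  have hss : s ^ 2 = p := Real.sq_sqrt (by positivity)
  have hs0 : 0 ≤ s := Real.sqrt_nonneg _
  have hp1 : (0 : ℝ) < (p : ℝ) - 1 := by linarith
  rcases hm with h | h
  · have h31 : 31 ≤ p := by
      have : p ≠ 25 := h25
      omega
    have hP : (31 : ℝ) ≤ p := by exact_mod_cast h31
    have hd : 0 < (p : ℝ) ^ 2 - 9 := by nlinarith
    unfold bnd
    rw [if_neg (by omega), if_pos h, div_le_div_iff₀ (by positivity) hd]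
    obtain ⟨t, ht⟩ : ∃ t : ℝ, (p : ℝ) = 31 + t := ⟨p - 31, by ring⟩
    have ht0 : 0 ≤ t := by linarith
    by_cases hn : (n : ZMod p) = 0
    · rw [hn]
      calc ‖TZ p 0‖ * ((p : ℝ) ^ 2 - 9) ≤ ((p - 1) * (2 * p + 1)) * ((p : ℝ) ^ 2 - 9) :=
            mul_le_mul_of_nonneg_right TZ_bound_zero hd.le
        _ ≤ _ := by
          rw [ht, ← sub_nonneg]
          ring_nf
          positivity
    · have hq : (s + 1) * Real.sqrt (15 * p + 3) ≤ 4.5834 * p := by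
        have h1 : Real.sqrt (15 * p + 3) ≤ 3.8855 * s := by
          apply Real.sqrt_le_iff.2
          constructor
          · positivity
          · nlinarith
        have h2 : s + 1 ≤ 1.17961 * s := by
          have : 5.5677 ≤ s := by
            apply Real.le_sqrt_of_sq_le
            norm_num; linarith
          linarith
        calc _ ≤ (1.17961 * s) * (3.8855 * s) := by
              apply mul_le_mul h2 h1 (Real.sqrt_nonneg _) (by positivity)
          _ = 1.17961 * 3.8855 * s ^ 2 := by ring
          _ ≤ _ := by
            rw [hss]
            have : (0 : ℝ) ≤ p := by linarith
            norm_num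
            linarith
      have hT := TZ_bound_ne (p := p) (by omega) (n : ZMod p) hn
      calc ‖TZ p (n : ZMod p)‖ * ((p : ℝ) ^ 2 - 9)
          ≤ ((s + 1) * ((2 * p + 1) * Real.sqrt (15 * p + 3))) * ((p : ℝ) ^ 2 - 9) :=
            mul_le_mul_of_nonneg_right hT hd.le
        _ = ((s + 1) * Real.sqrt (15 * p + 3)) * ((2 * p + 1) * ((p : ℝ) ^ 2 - 9)) := by ring
        _ ≤ (4.5834 * p) * ((2 * p + 1) * ((p : ℝ) ^ 2 - 9)) :=
            mul_le_mul_of_nonneg_right hq (by positivity)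
        _ ≤ _ := by
          rw [ht, ← sub_nonneg]
          ring_nf
          positivity
  · have hd : 0 < (p : ℝ) ^ 2 - 9 := by nlinarith
    unfold bnd
    rw [if_neg (by omega), if_neg (by omega), if_pos h, div_le_div_iff₀ (by positivity) hd]
    obtain ⟨t, ht⟩ : ∃ t : ℝ, (p : ℝ) = 23 + t := ⟨p - 23, by ring⟩
    have ht0 : 0 ≤ t := by linarith
    have hq : s + 1 ≤ 0.2522 * p := by
      have : 4.79 ≤ s := by
        apply Real.le_sqrt_of_sq_le
        norm_num; linarith
      nlinarith
    have hc : Nat.Coprime (p - 1) 3 := by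
      rw [Nat.coprime_comm, Nat.Prime.coprime_iff_not_dvd Nat.prime_three]
      omega
    have hT := TZ_bound_two (p := p) (by omega) hc (n := (n : ZMod p))
    calc ‖TZ p (n : ZMod p)‖ * ((p : ℝ) ^ 2 - 9)
        ≤ ((p - 1) * (s + 1)) * ((p : ℝ) ^ 2 - 9) := mul_le_mul_of_nonneg_right hT hd.le
      _ = (s + 1) * ((p - 1) * ((p : ℝ) ^ 2 - 9)) := by ring
      _ ≤ (0.2522 * p) * ((p - 1) * ((p : ℝ) ^ 2 - 9)) :=
          mul_le_mul_of_nonneg_right hq (by positivity)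
      _ ≤ _ := by
        rw [ht, ← sub_nonneg]
        ring_nf
        positivity

lemma Ac_summable' (n : ℕ) : Summable (fun q => ‖Ac n q‖) :=
  Ac_summable n bnd bnd_summable bnd_nonneg (Ac_bnd n)


lemma digit_sum_lt (B q : ℕ) (hB : 2 ≤ B) (c : ℕ → ℕ) (hc : ∀ s, c s < B) :
    ∑ i ∈ Finset.range q, c i * B ^ i < B ^ q := by
  induction q with
  | zero => simp
  | succ q ih =>
    rw [Finset.sum_range_succ, pow_succ]
    have := hc q
    have h2 : c q * B ^ q ≤ (B - 1) * B ^ q := Nat.mul_le_mul_right _ (by omega)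
    have h3 : (B - 1) * B ^ q + B ^ q = B ^ q * B := by
      obtain ⟨b, rfl⟩ : ∃ b, B = b + 1 := ⟨B - 1, by omega⟩
      simp only [Nat.add_sub_cancel]
      ring
    omega

lemma digit_extract (B q : ℕ) (hB : 2 ≤ B) (c : ℕ → ℕ) (hc : ∀ s, c s < B) (s : ℕ) (hs : s < q) :
    (∑ i ∈ Finset.range q, c i * B ^ i) / B ^ s % B = c s := by
  obtain ⟨r, rfl⟩ : ∃ r, q = s + (r + 1) := ⟨q - s - 1, by omega⟩
  rw [Finset.sum_range_add]
  have h1 : ∑ x ∈ Finset.range (r + 1), c (s + x) * B ^ (s + x) =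
      B ^ s * (c s + B * ∑ x ∈ Finset.range r, c (s + (x + 1)) * B ^ x) := by
    rw [Finset.sum_range_succ', mul_add, add_comm]
    congr 1
    · simp [mul_comm]
    · rw [Finset.mul_sum, Finset.mul_sum]
      refine Finset.sum_congr rfl fun x _ => ?_
      ring
  rw [h1, Nat.add_mul_div_left _ _ (by positivity),
    Nat.div_eq_of_lt (digit_sum_lt B s hB c hc), zero_add, Nat.add_mul_mod_self_left,
    Nat.mod_eq_of_lt (hc s)]

/-- Counting residues by Kronecker substitution. -/
lemma kron {τ : Type*} (S : Finset τ) (F : τ → ℕ) (q B : ℕ) (hq : 0 < q) (hB : S.card + 2 ≤ B)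
    (s : ℕ) (hs : s < q) :
    (S.filter (fun x => F x % q = s)).card = (∑ x ∈ S, B ^ F x) % (B ^ q - 1) / B ^ s % B := by
  set c : ℕ → ℕ := fun s => (S.filter (fun x => F x % q = s)).card with hcdef
  have hcle : ∀ s, c s + 2 ≤ B := fun s =>
    le_trans (Nat.add_le_add_right (Finset.card_filter_le _ _) 2) hB
  have hc : ∀ s, c s < B := fun s => by have := hcle s; omega
  have hB2 : 2 ≤ B := by omega
  have hBq : 1 ≤ B ^ q := Nat.one_le_pow _ _ (by omega)
  have hpow : B ^ q ≡ 1 [MOD (B ^ q - 1)] := by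
    have h := (Nat.modEq_iff_dvd' hBq).2 (dvd_refl (B ^ q - 1))
    exact h.symm
  have h1 : ∑ x ∈ S, B ^ F x ≡ ∑ x ∈ S, B ^ (F x % q) [MOD (B ^ q - 1)] := by
    apply Nat.ModEq.sum
    intro x _
    conv_lhs => rw [← Nat.div_add_mod (F x) q, pow_add, pow_mul]
    have := (hpow.pow (F x / q)).mul_right (B ^ (F x % q))
    simpa using this
  have h2 : ∑ x ∈ S, B ^ (F x % q) = ∑ i ∈ Finset.range q, c i * B ^ i := by
    rw [← Finset.sum_fiberwise_of_maps_to (g := fun x => F x % q) (t := Finset.range q)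
      (fun x _ => Finset.mem_range.2 (Nat.mod_lt _ hq))]
    refine Finset.sum_congr rfl fun i _ => ?_
    rw [Finset.sum_congr rfl (g := fun _ => B ^ i) (fun x hx => by
      rw [(Finset.mem_filter.1 hx).2])]
    simp [hcdef]
  have h3 : ∑ i ∈ Finset.range q, c i * B ^ i < B ^ q - 1 := by
    have h := digit_sum_lt B q hB2 (fun s => c s + 1) (fun s => by have := hcle s; omega)
    simp only [add_mul, one_mul, Finset.sum_add_distrib] at h
    have : 1 ≤ ∑ i ∈ Finset.range q, B ^ i := by
      calc 1 = B ^ 0 := by simp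
        _ ≤ _ := Finset.single_le_sum (f := fun i => B ^ i) (fun _ _ => Nat.zero_le _)
          (Finset.mem_range.2 hq)
    omega
  have h4 : (∑ x ∈ S, B ^ F x) % (B ^ q - 1) = ∑ i ∈ Finset.range q, c i * B ^ i := by
    rw [h1, h2, Nat.mod_eq_of_lt h3]
  rw [h4, digit_extract B q hB2 c hc s hs]

lemma sum_units_nat (p : ℕ) [hp : Fact p.Prime] (f : ℕ → ℕ) :
    ∑ u : (ZMod p)ˣ, f (u : ZMod p).val = ∑ x ∈ Finset.Icc 1 (p - 1), f x := by
  have hp1 := hp.out.one_lt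
  refine Finset.sum_bij (fun u _ => (u : ZMod p).val) ?_ ?_ ?_ ?_
  · intro u _
    rw [Finset.mem_Icc]
    have h1 := ZMod.val_lt (u : ZMod p)
    have h2 : (u : ZMod p).val ≠ 0 := by
      rw [Ne, ZMod.val_eq_zero]
      exact u.ne_zero
    omega
  · intro u _ v _ h
    exact Units.ext (ZMod.val_injective p h)
  · intro x hx
    rw [Finset.mem_Icc] at hx
    have hx0 : (x : ZMod p) ≠ 0 := by
      rw [Ne, ZMod.natCast_eq_zero_iff]
      intro h
      have := Nat.le_of_dvd (by omega) h
      omega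
    refine ⟨Units.mk0 (x : ZMod p) hx0, Finset.mem_univ _, ?_⟩
    simp only [Units.val_mk0]
    exact ZMod.val_cast_of_lt (by omega)
  · intro u _
    rfl

/-- The generating number of the local counts. -/
def mpK (p : ℕ) : ℕ :=
  ((∑ x ∈ Finset.Icc 1 (p - 1), 65536 ^ (x ^ 2 % p)) *
    (∑ x ∈ Finset.Icc 1 (p - 1), 65536 ^ (x ^ 3 % p)) ^ 2) % (65536 ^ p - 1)

def uN (p n : ℕ) : ℕ := (p - 1) ^ 3 - mpK p / 65536 ^ n % 65536

lemma Mp_eq (p : ℕ) [hp : Fact p.Prime] (h : p ≤ 19) (n : ZMod p) :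
    Mp p n = mpK p / 65536 ^ n.val % 65536 := by
  have hp1 := hp.out.one_lt
  have hcard : (Finset.univ : Finset ((ZMod p)ˣ × (ZMod p)ˣ × (ZMod p)ˣ)).card = (p - 1) ^ 3 := by
    rw [Finset.card_univ, Fintype.card_prod, Fintype.card_prod, ZMod.card_units]
    ring
  have h18 : (p - 1) ^ 3 ≤ 18 ^ 3 := Nat.pow_le_pow_left (by omega) 3
  have hk := kron (Finset.univ : Finset ((ZMod p)ˣ × (ZMod p)ˣ × (ZMod p)ˣ))
    (fun x => (x.1 : ZMod p).val ^ 2 % p + ((x.2.1 : ZMod p).val ^ 3 % p + (x.2.2 : ZMod p).val ^ 3 % p))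
    p 65536 (by omega) (by rw [hcard]; omega) n.val (ZMod.val_lt n)
  have hM : Mp p n = ((Finset.univ : Finset ((ZMod p)ˣ × (ZMod p)ˣ × (ZMod p)ˣ)).filter
      (fun x => ((x.1 : ZMod p).val ^ 2 % p + ((x.2.1 : ZMod p).val ^ 3 % p +
        (x.2.2 : ZMod p).val ^ 3 % p)) % p = n.val)).card := by
    unfold Mp
    congr 1
    refine Finset.filter_congr fun x _ => ?_
    rw [← (ZMod.val_injective p).eq_iff]
    have : ((x.1 : ZMod p) ^ 2 + (x.2.1 : ZMod p) ^ 3 + (x.2.2 : ZMod p) ^ 3) =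
       (((x.1 : ZMod p).val ^ 2 % p + ((x.2.1 : ZMod p).val ^ 3 % p +
        (x.2.2 : ZMod p).val ^ 3 % p) : ℕ) : ZMod p) := by
      push_cast
      simp [add_assoc]
    rw [this, ZMod.val_natCast]
  rw [hM, hk]
  congr 2
  rw [mpK]
  congr 1
  simp_rw [pow_add]
  rw [Fintype.sum_prod_type]
  simp_rw [← Finset.mul_sum]
  rw [← Finset.sum_mul, Fintype.sum_prod_type]
  simp_rw [← Finset.mul_sum]
  rw [← Finset.sum_mul, sum_units_nat p (fun x => 65536 ^ (x ^ 2 % p)),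
    sum_units_nat p (fun x => 65536 ^ (x ^ 3 % p)), ← pow_two]

lemma lw_eq (p : ℕ) [hp : Fact p.Prime] (h : p ≤ 19) (n : ZMod p) :
    lw p n = p / ((p : ℝ) - 1) ^ 4 * (uN p n.val : ℝ) := by
  have hp1 := hp.out.one_lt
  have h1 := Mp_le n
  rw [lw, uN, ← Mp_eq p h n, Nat.cast_sub h1]
  push_cast [Nat.cast_sub hp1.le]
  ring


lemma corr3 : ∀ a b : ZMod 3, 84 ≤ ∑ s : ZMod 3, uN 3 (a - s).val * uN 3 (b - s).val := by
  decide +kernel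
lemma corr5 : ∀ a b : ZMod 5, 13104 ≤ ∑ s : ZMod 5, uN 5 (a - s).val * uN 5 (b - s).val := by
  decide +kernel
lemma corr7 : ∀ a b : ZMod 7, 238464 ≤ ∑ s : ZMod 7, uN 7 (a - s).val * uN 7 (b - s).val := by
  decide +kernel
lemma corr13 : ∀ a b : ZMod 13,
    33061932 ≤ ∑ s : ZMod 13, uN 13 (a - s).val * uN 13 (b - s).val := by
  decide +kernel
lemma uN2 : uN 2 0 = 1 := by decide +kernel
lemma uN11 : ∀ n < 11, 908 ≤ uN 11 n := by decide +kernel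
lemma uN17 : ∀ n < 17, 3854 ≤ uN 17 n := by decide +kernel
lemma uN19 : ∀ n < 19, 5454 ≤ uN 19 n := by decide +kernel

/-- Generating number of the counts of sums of `k` powers of two modulo `q`. -/
def genK (B q k : ℕ) : ℕ := ((∑ v ∈ Finset.Icc 1 12, B ^ (2 ^ v % q)) ^ k) % (B ^ q - 1)

lemma cnt_min : ∀ s < 1365, 135165698866782 ≤ genK (2 ^ 64) 1365 16 / (2 ^ 64) ^ s % 2 ^ 64 := by
  decide +kernel


instance fact3' : Fact (Nat.Prime 3) := ⟨by norm_num⟩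
instance fact5' : Fact (Nat.Prime 5) := ⟨by norm_num⟩
instance fact7' : Fact (Nat.Prime 7) := ⟨by norm_num⟩
instance fact11' : Fact (Nat.Prime 11) := ⟨by norm_num⟩
instance fact13' : Fact (Nat.Prime 13) := ⟨by norm_num⟩
instance fact17' : Fact (Nat.Prime 17) := ⟨by norm_num⟩
instance fact19' : Fact (Nat.Prime 19) := ⟨by norm_num⟩

lemma one_sub_sum_le_prod (s : Finset ℕ) (w b : ℕ → ℝ) (hb : ∀ i ∈ s, 0 ≤ b i)
    (hw : ∀ i ∈ s, 1 - b i ≤ w i) (hw0 : ∀ i ∈ s, 0 ≤ w i) (hs : ∑ i ∈ s, b i ≤ 1) :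
    1 - ∑ i ∈ s, b i ≤ ∏ i ∈ s, w i := by
  induction s using Finset.induction_on with
  | empty => simp
  | insert i s hi ih =>
    rw [Finset.sum_insert hi, Finset.prod_insert hi]
    rw [Finset.sum_insert hi] at hs
    have hbi := hb i (Finset.mem_insert_self _ _)
    have hwi := hw i (Finset.mem_insert_self _ _)
    have hw0i := hw0 i (Finset.mem_insert_self _ _)
    have hsn : 0 ≤ ∑ i ∈ s, b i := Finset.sum_nonneg fun j hj => hb j (Finset.mem_insert_of_mem hj)
    have ih' := ih (fun j hj => hb j (Finset.mem_insert_of_mem hj))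
      (fun j hj => hw j (Finset.mem_insert_of_mem hj))
      (fun j hj => hw0 j (Finset.mem_insert_of_mem hj)) (by linarith)
    have h1 : w i * (1 - ∑ i ∈ s, b i) ≤ w i * ∏ i ∈ s, w i := mul_le_mul_of_nonneg_left ih' hw0i
    have h2 : (1 - b i) * (1 - ∑ i ∈ s, b i) ≤ w i * (1 - ∑ i ∈ s, b i) :=
      mul_le_mul_of_nonneg_right hwi (by linarith)
    nlinarith [mul_nonneg hbi hsn]

/-- The residue ring modulo `1365`, as a product. -/
abbrev GG : Type := ZMod 3 × ZMod 5 × ZMod 7 × ZMod 13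

def WW (x : GG) : ℝ := lw 3 x.1 * lw 5 x.2.1 * lw 7 x.2.2.1 * lw 13 x.2.2.2

lemma WW_nonneg (x : GG) : 0 ≤ WW x := by
  unfold WW
  have h1 := lw_nonneg x.1
  have h2 := lw_nonneg x.2.1
  have h3 := lw_nonneg x.2.2.1
  have h4 := lw_nonneg x.2.2.2
  positivity

lemma primesBelow23 : Nat.primesBelow 23 = {2, 3, 5, 7, 11, 13, 17, 19} := by decide +kernel

lemma SSfun_lower (n : ℕ) (hn : Even n) : 1.837 * WW (n : GG) ≤ SSfun n := by
  set w : ℕ → ℝ := fun p => if h : p.Prime then @lw p ⟨h⟩ (n : ZMod p) else 0 with hwdef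
  refine SSfun_ge n (Ac_summable' n) w ?_ _ 23 ?_
  · intro p hp
    simp only [hwdef, hp, dif_pos]
    exact @one_add_Ac p ⟨hp⟩ n
  · intro X hX
    have hsub : Nat.primesBelow 23 ⊆ Nat.primesBelow X := by
      intro p hp
      rw [Nat.mem_primesBelow] at hp ⊢
      exact ⟨by omega, hp.2⟩
    rw [← Finset.prod_sdiff hsub]
    have hbs := bnd_sum_le (Nat.primesBelow X \ Nat.primesBelow 23)
    have htail : 0.9332 ≤ ∏ p ∈ Nat.primesBelow X \ Nat.primesBelow 23, w p := by
      have := one_sub_sum_le_prod (Nat.primesBelow X \ Nat.primesBelow 23) w bnd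
        (fun i _ => bnd_nonneg i) (fun i hi => ?_) (fun i hi => ?_) (by linarith)
      · norm_num at hbs this ⊢
        linarith
      · rw [Finset.mem_sdiff, Nat.mem_primesBelow, Nat.mem_primesBelow] at hi
        have hip := hi.1.2
        have h23 : 23 ≤ i := by
          by_contra h
          exact hi.2 ⟨by omega, hip⟩
        simp only [hwdef, hip, dif_pos]
        have h1 := @lw_ge i ⟨hip⟩ n
        have h2 := Ac_bnd n i hip h23
        linarith
      · rw [Finset.mem_sdiff, Nat.mem_primesBelow] at hi
        have hip := hi.1.2
        simp only [hwdef, hip, dif_pos]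
        exact @lw_nonneg i ⟨hip⟩ _
    have hw : ∀ (p : ℕ) [h : Fact p.Prime], w p = lw p (n : ZMod p) := by
      intro p h
      simp only [hwdef, h.out, dif_pos]
    have h2 : w 2 = 2 := by
      rw [hw 2, lw_eq 2 (by norm_num), (ZMod.natCast_eq_zero_iff_even).2 hn]
      rw [ZMod.val_zero, uN2]
      norm_num
    have h11 : 0.9988 ≤ w 11 := by
      rw [hw 11, lw_eq 11 (by norm_num)]
      have : (908 : ℝ) ≤ uN 11 (n : ZMod 11).val := by exact_mod_cast uN11 _ (ZMod.val_lt _)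
      generalize uN 11 (n : ZMod 11).val = y at this ⊢
      norm_num
      linarith
    have h17 : 0.9997 ≤ w 17 := by
      rw [hw 17, lw_eq 17 (by norm_num)]
      have : (3854 : ℝ) ≤ uN 17 (n : ZMod 17).val := by exact_mod_cast uN17 _ (ZMod.val_lt _)
      generalize uN 17 (n : ZMod 17).val = y at this ⊢
      norm_num
      linarith
    have h19 : 0.9871 ≤ w 19 := by
      rw [hw 19, lw_eq 19 (by norm_num)]
      have : (5454 : ℝ) ≤ uN 19 (n : ZMod 19).val := by exact_mod_cast uN19 _ (ZMod.val_lt _)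
      generalize uN 19 (n : ZMod 19).val = y at this ⊢
      norm_num
      linarith
    have hW : WW (n : GG) = w 3 * w 5 * w 7 * w 13 := by
      rw [hw 3, hw 5, hw 7, hw 13]
      rfl
    have hW0 := WW_nonneg (n : GG)
    have hprod : ∏ p ∈ Nat.primesBelow 23, w p = 2 * (w 11 * w 17 * w 19) * WW (n : GG) := by
      rw [primesBelow23, hW, ← h2]
      simp
      ring
    rw [hprod]
    set T := ∏ p ∈ Nat.primesBelow X \ Nat.primesBelow 23, w p
    have hc : (0.9988 * 0.9997 * 0.9871 : ℝ) ≤ w 11 * w 17 * w 19 := by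
      gcongr
    have hc2 : 0.9332 * (0.9988 * 0.9997 * 0.9871 : ℝ) ≤ T * (w 11 * w 17 * w 19) :=
      mul_le_mul htail hc (by norm_num) (by linarith)
    calc 1.837 * WW (n : GG) ≤ (2 * (0.9332 * (0.9988 * 0.9997 * 0.9871 : ℝ))) * WW (n : GG) := by
          apply mul_le_mul_of_nonneg_right _ hW0
          norm_num
      _ ≤ (2 * (T * (w 11 * w 17 * w 19))) * WW (n : GG) := by
          apply mul_le_mul_of_nonneg_right _ hW0
          linarith
      _ = _ := by ring

lemma lw_corr (p : ℕ) [hp : Fact p.Prime] (h : p ≤ 19) (c : ℕ)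
    (hc : ∀ a b : ZMod p, c ≤ ∑ s : ZMod p, uN p (a - s).val * uN p (b - s).val) (a b : ZMod p) :
    (p / ((p : ℝ) - 1) ^ 4) ^ 2 * c ≤ ∑ s : ZMod p, lw p (a - s) * lw p (b - s) := by
  have h1 : ∑ s : ZMod p, lw p (a - s) * lw p (b - s) =
      (p / ((p : ℝ) - 1) ^ 4) ^ 2 * ((∑ s : ZMod p, uN p (a - s).val * uN p (b - s).val : ℕ) : ℝ) := by
    push_cast
    rw [Finset.mul_sum]
    refine Finset.sum_congr rfl fun s _ => ?_
    rw [lw_eq p h, lw_eq p h]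
    ring
  rw [h1]
  apply mul_le_mul_of_nonneg_left _ (by positivity)
  exact_mod_cast hc a b

lemma WW_corr (a b : GG) : 1334.5 ≤ ∑ g : GG, WW (a - g) * WW (b - g) := by
  have h : ∑ g : GG, WW (a - g) * WW (b - g) =
      (∑ s, lw 3 (a.1 - s) * lw 3 (b.1 - s)) * ((∑ s, lw 5 (a.2.1 - s) * lw 5 (b.2.1 - s)) *
      ((∑ s, lw 7 (a.2.2.1 - s) * lw 7 (b.2.2.1 - s)) *
        (∑ s, lw 13 (a.2.2.2 - s) * lw 13 (b.2.2.2 - s)))) := by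
    rw [Fintype.sum_prod_type, Finset.sum_mul]
    refine Finset.sum_congr rfl fun s _ => ?_
    rw [Fintype.sum_prod_type, Finset.sum_mul, Finset.mul_sum]
    refine Finset.sum_congr rfl fun s _ => ?_
    rw [Fintype.sum_prod_type, Finset.sum_mul, Finset.mul_sum, Finset.mul_sum]
    refine Finset.sum_congr rfl fun s _ => ?_
    rw [Finset.mul_sum, Finset.mul_sum, Finset.mul_sum]
    refine Finset.sum_congr rfl fun s _ => ?_
    simp only [WW, Prod.fst_sub, Prod.snd_sub]
    ring
  rw [h]
  have h3 := lw_corr 3 (by norm_num) 84 corr3 a.1 b.1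
  have h5 := lw_corr 5 (by norm_num) 13104 corr5 a.2.1 b.2.1
  have h7 := lw_corr 7 (by norm_num) 238464 corr7 a.2.2.1 b.2.2.1
  have h13 := lw_corr 13 (by norm_num) 33061932 corr13 a.2.2.2 b.2.2.2
  refine le_trans ?_ (mul_le_mul h3 (mul_le_mul h5 (mul_le_mul h7 h13 (by positivity)
    (le_trans (by positivity) h7)) (by positivity) (le_trans (by positivity) h5)) (by positivity)
    (le_trans (by positivity) h3))
  norm_num


lemma sum_pi_succ {M : Type*} [AddCommMonoid M] (k : ℕ) (I : Finset ℕ) (f : (Fin (k + 1) → ℕ) → M) :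
    ∑ v ∈ Fintype.piFinset (fun _ : Fin (k + 1) => I), f v =
      ∑ a ∈ I, ∑ v ∈ Fintype.piFinset (fun _ : Fin k => I), f (Fin.cons a v) := by
  rw [← Finset.sum_product']
  refine Finset.sum_bij' (fun v _ => (v 0, Fin.tail v)) (fun x _ => Fin.cons x.1 x.2) ?_ ?_ ?_ ?_ ?_
  · intro v hv
    rw [Fintype.mem_piFinset] at hv
    rw [Finset.mem_product, Fintype.mem_piFinset]
    exact ⟨hv 0, fun i => hv i.succ⟩
  · intro x hx
    rw [Finset.mem_product, Fintype.mem_piFinset] at hx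
    rw [Fintype.mem_piFinset]
    intro i
    refine Fin.cases ?_ (fun j => ?_) i
    · exact hx.1
    · exact hx.2 j
  · intro v _
    exact Fin.cons_self_tail v
  · intro x _
    simp
  · intro v _
    rw [Fin.cons_self_tail]

/-- Sum of `H (a + 2^{v₁} + ⋯ + 2^{v_k})` over `1 ≤ v_j ≤ 12 m`. -/
def opS (H : ZMod 1365 → ℝ) (m k : ℕ) (a : ZMod 1365) : ℝ :=
  ∑ v ∈ Fintype.piFinset (fun _ : Fin k => Finset.Icc 1 (12 * m)), H (a + ∑ j, 2 ^ (v j))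

lemma opS_succ (H : ZMod 1365 → ℝ) (m k : ℕ) (a : ZMod 1365) :
    opS H m (k + 1) a = ∑ t ∈ Finset.Icc 1 (12 * m), opS H m k (a + 2 ^ t) := by
  unfold opS
  rw [sum_pi_succ]
  refine Finset.sum_congr rfl fun t _ => Finset.sum_congr rfl fun v _ => ?_
  rw [Fin.sum_univ_succ]
  simp [add_assoc]

lemma two_pow_period (t : ℕ) : (2 : ZMod 1365) ^ (12 + t) = 2 ^ t := by
  rw [pow_add]
  have : (2 : ZMod 1365) ^ 12 = 1 := by decide +kernel
  rw [this, one_mul]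

lemma sum_period (f : ZMod 1365 → ℝ) (m : ℕ) :
    ∑ t ∈ Finset.Icc 1 (12 * m), f (2 ^ t) = m * ∑ t ∈ Finset.Icc 1 12, f (2 ^ t) := by
  have h : ∀ n : ℕ, ∑ t ∈ Finset.Icc 1 n, f (2 ^ t) = ∑ t ∈ Finset.range n, f (2 ^ (t + 1)) := by
    intro n
    rw [Finset.range_eq_Ico, Finset.sum_Ico_add' (fun t => f (2 ^ t)) 0 n 1]
    rfl
  rw [h, h]
  induction m with
  | zero => simp
  | succ m ih =>
    rw [show 12 * (m + 1) = 12 + 12 * m by ring, Finset.sum_range_add]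
    have : ∀ x, f (2 ^ (12 + x + 1)) = f (2 ^ (x + 1)) := by
      intro x
      rw [add_assoc, two_pow_period]
    simp_rw [this]
    rw [ih]
    push_cast
    ring

lemma opS_period (H : ZMod 1365 → ℝ) (m k : ℕ) (a : ZMod 1365) :
    opS H m k a = (m : ℝ) ^ k * opS H 1 k a := by
  induction k generalizing a with
  | zero => simp [opS]
  | succ k ih =>
    rw [opS_succ, opS_succ]
    simp_rw [ih]
    rw [sum_period (fun x => (m : ℝ) ^ k * opS H 1 k (a + x)), ← Finset.mul_sum]
    ring

lemma count_gen (q k B : ℕ) [NeZero q] (hB : 12 ^ k + 2 ≤ B) (g : ZMod q) :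
    ((Fintype.piFinset (fun _ : Fin k => Finset.Icc 1 12)).filter
      (fun v => ∑ j, (2 : ZMod q) ^ (v j) = g)).card = genK B q k / B ^ g.val % B := by
  have hk := kron (Fintype.piFinset (fun _ : Fin k => Finset.Icc 1 12))
    (fun v => ∑ j, 2 ^ (v j) % q) q B (NeZero.pos q)
    (by rw [Fintype.card_piFinset_const]; simpa using hB) g.val (ZMod.val_lt g)
  have hs : ∑ v ∈ Fintype.piFinset (fun _ : Fin k => Finset.Icc 1 12),
      B ^ (∑ j, 2 ^ (v j) % q) = (∑ v ∈ Finset.Icc 1 12, B ^ (2 ^ v % q)) ^ k := by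
    have := Finset.prod_univ_sum (fun _ : Fin k => Finset.Icc 1 12)
      (fun _ v => B ^ (2 ^ v % q))
    rw [Finset.prod_const, Finset.card_univ, Fintype.card_fin] at this
    rw [this]
    refine Finset.sum_congr rfl fun v _ => ?_
    rw [Finset.prod_pow_eq_pow_sum]
  have hf : (Fintype.piFinset (fun _ : Fin k => Finset.Icc 1 12)).filter
      (fun v => ∑ j, (2 : ZMod q) ^ (v j) = g) =
      (Fintype.piFinset (fun _ : Fin k => Finset.Icc 1 12)).filter
      (fun v => (∑ j, 2 ^ (v j) % q) % q = g.val) := by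
    refine Finset.filter_congr fun v _ => ?_
    rw [← (ZMod.val_injective q).eq_iff]
    have : ∑ j, (2 : ZMod q) ^ (v j) = ((∑ j, 2 ^ (v j) % q : ℕ) : ZMod q) := by
      rw [Nat.cast_sum]
      refine Finset.sum_congr rfl fun j _ => ?_
      rw [ZMod.natCast_mod]
      push_cast
      rfl
    rw [this, ZMod.val_natCast]
  rw [hf, hk, hs, genK]

lemma count16 (g : ZMod 1365) : 135165698866782 ≤
    ((Fintype.piFinset (fun _ : Fin 16 => Finset.Icc 1 12)).filter
      (fun v => ∑ j, (2 : ZMod 1365) ^ (v j) = g)).card :=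
  le_of_le_of_eq (cnt_min g.val (ZMod.val_lt g)) (count_gen 1365 16 (2 ^ 64) (by norm_num) g).symm

lemma opS_16 (H : ZMod 1365 → ℝ) (hH : ∀ x, 0 ≤ H x) (a : ZMod 1365) :
    135165698866782 * ∑ x, H x ≤ opS H 1 16 a := by
  unfold opS
  rw [mul_one, ← Finset.sum_fiberwise (Fintype.piFinset (fun _ : Fin 16 => Finset.Icc 1 12))
    (fun v => ∑ j, (2 : ZMod 1365) ^ (v j)), ← Equiv.sum_comp (Equiv.addLeft a) H, Finset.mul_sum]
  refine Finset.sum_le_sum fun g _ => ?_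
  rw [Finset.sum_congr rfl (g := fun _ => H (a + g)) (fun v hv => by
    rw [(Finset.mem_filter.1 hv).2])]
  rw [Finset.sum_const, nsmul_eq_mul]
  refine mul_le_mul_of_nonneg_right ?_ (hH _)
  exact_mod_cast count16 g

lemma opS_lower (H : ZMod 1365 → ℝ) (hH : ∀ x, 0 ≤ H x) (m j : ℕ) (a : ZMod 1365) :
    (12 * (m : ℝ)) ^ (16 + j) * (135165698866782 / 12 ^ 16 * ∑ x, H x) ≤ opS H m (16 + j) a := by
  induction j generalizing a with
  | zero =>
    rw [add_zero, opS_period]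
    have := mul_le_mul_of_nonneg_left (opS_16 H hH a) (by positivity : (0 : ℝ) ≤ (m : ℝ) ^ 16)
    refine le_trans (le_of_eq ?_) this
    ring
  | succ j ih =>
    rw [← add_assoc, opS_succ]
    calc _ = ∑ t ∈ Finset.Icc 1 (12 * m),
          (12 * (m : ℝ)) ^ (16 + j) * (135165698866782 / 12 ^ 16 * ∑ x, H x) := by
          rw [Finset.sum_const, nsmul_eq_mul, Nat.card_Icc, pow_succ]
          rw [Nat.add_sub_cancel]
          push_cast
          ring
      _ ≤ _ := Finset.sum_le_sum fun t _ => ih _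

def crtE : ZMod 1365 ≃+* GG :=
  (ZMod.chineseRemainder (m := 3) (n := 455) (by norm_num)).trans
    (RingEquiv.prodCongr (RingEquiv.refl _)
      ((ZMod.chineseRemainder (m := 5) (n := 91) (by norm_num)).trans
        (RingEquiv.prodCongr (RingEquiv.refl _)
          (ZMod.chineseRemainder (m := 7) (n := 13) (by norm_num)))))

lemma WW_avg (k m : ℕ) (hk : 16 ≤ k) (A B : GG) :
    3.261435 / 1.837 ^ 2 * (12 * (m : ℝ)) ^ k ≤
      ∑ v ∈ Fintype.piFinset (fun _ : Fin k => Finset.Icc 1 (12 * m)),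
        WW (A - ((∑ j, 2 ^ (v j) : ℕ) : GG)) * WW (B - ((∑ j, 2 ^ (v j) : ℕ) : GG)) := by
  obtain ⟨j, rfl⟩ := Nat.exists_eq_add_of_le hk
  set H : ZMod 1365 → ℝ := fun x => WW (A - crtE x) * WW (B - crtE x) with hH
  have h := opS_lower H (fun x => mul_nonneg (WW_nonneg _) (WW_nonneg _)) m j 0
  have hsum : ∑ x, H x = ∑ g : GG, WW (A - g) * WW (B - g) :=
    Equiv.sum_comp crtE.toEquiv (fun g => WW (A - g) * WW (B - g))
  have hc := WW_corr A B
  rw [← hsum] at hc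
  have he : opS H m (16 + j) 0 = ∑ v ∈ Fintype.piFinset (fun _ : Fin (16 + j) => Finset.Icc 1 (12 * m)),
        WW (A - ((∑ j, 2 ^ (v j) : ℕ) : GG)) * WW (B - ((∑ j, 2 ^ (v j) : ℕ) : GG)) := by
    unfold opS
    refine Finset.sum_congr rfl fun v _ => ?_
    have : crtE (0 + ∑ j, (2 : ZMod 1365) ^ (v j)) = ((∑ j, 2 ^ (v j) : ℕ) : GG) := by
      rw [← map_natCast crtE]
      push_cast
      rw [zero_add]
    simp only [hH]
    rw [this]
  rw [← he]
  refine le_trans ?_ h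
  rw [mul_comm]
  refine mul_le_mul_of_nonneg_left ?_ (pow_nonneg (mul_nonneg (by norm_num) (Nat.cast_nonneg m)) _)
  calc (3.261435 / 1.837 ^ 2 : ℝ) ≤ 135165698866782 / 12 ^ 16 * 1334.5 := by norm_num
    _ ≤ _ := mul_le_mul_of_nonneg_left hc (by norm_num)


lemma bern_aux (L x : ℝ) (k : ℕ) (hk : 1 ≤ k) (hL : 0 < L) (hx : x ≤ L) :
    L ^ k - k * x * L ^ (k - 1) ≤ (L - x) ^ k := by
  have h1 : -2 ≤ -(x / L) := by
    have : x / L ≤ 1 := (div_le_one hL).2 hx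
    linarith
  have h := one_add_mul_le_pow h1 k
  have h2 := mul_le_mul_of_nonneg_left h (by positivity : 0 ≤ L ^ k)
  rw [← mul_pow] at h2
  have e1 : L * (1 + -(x / L)) = L - x := by field_simp; ring
  have e2 : L ^ k * (1 + k * -(x / L)) = L ^ k - k * x * L ^ (k - 1) := by
    obtain ⟨j, rfl⟩ : ∃ j, k = j + 1 := ⟨k - 1, by omega⟩
    rw [Nat.add_sub_cancel, pow_succ]
    field_simp
    ring
  rwa [e1, e2] at h2

lemma SSfun_nonneg (n : ℕ) (hn : Even n) : 0 ≤ SSfun n :=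
  le_trans (mul_nonneg (by norm_num) (WW_nonneg _)) (SSfun_lower n hn)

lemma even_sum_pow (k : ℕ) (v : Fin k → ℕ) (hv : ∀ j, 1 ≤ v j) : Even (∑ j, 2 ^ (v j)) := by
  apply Finset.even_sum
  intro j _
  exact (even_two).pow_of_ne_zero (by have := hv j; omega)

theorem singular_series_sum_lower_bound (k : ℕ) (hk : 27 ≤ k) (c : ℝ) (hc : 1 ≤ c) :
    ∃ C > (0 : ℝ), ∃ N₀ : ℕ, ∀ N₁ N₂ : ℕ,
      Even N₁ → Even N₂ → N₀ ≤ N₂ → N₂ < N₁ → (N₁ : ℝ) ≤ c * N₂ →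
      3.261435 * Real.logb 2 N₁ ^ k - C * Real.logb 2 N₁ ^ (k - 1) ≤
        ∑ v ∈ (Fintype.piFinset fun _ : Fin k => Finset.Icc 1 ⌊Real.logb 2 N₁⌋₊).filter
            (fun v => (∑ j, 2 ^ (v j)) + 2 ≤ N₁ ∧ (∑ j, 2 ^ (v j)) + 2 ≤ N₂),
          SSfun (N₁ - ∑ j, 2 ^ (v j)) * SSfun (N₂ - ∑ j, 2 ^ (v j)) := by
  obtain ⟨D, hD⟩ : ∃ D : ℕ, 2 * k * c ≤ 2 ^ D := by
    obtain ⟨D, hD⟩ := pow_unbounded_of_one_lt (2 * k * c) (by norm_num : (1 : ℝ) < 2)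
    exact ⟨D, hD.le⟩
  have hk0 : (0 : ℝ) < k := by
    have : 0 < k := by omega
    exact_mod_cast this
  refine ⟨3.261435 * (k * (D + 12)), by positivity, 2 ^ (D + 12), ?_⟩
  intro N₁ N₂ hN₁ hN₂ hN₀ hlt hle
  set L := Real.logb 2 N₁ with hLdef
  have hN1big : (2 : ℝ) ^ (D + 12) ≤ N₁ := by
    have : 2 ^ (D + 12) ≤ N₁ := by omega
    exact_mod_cast this
  have hN1pos : (0 : ℝ) < N₁ := lt_of_lt_of_le (by positivity) hN1big
  have hLD : (D : ℝ) + 12 ≤ L := by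
    rw [hLdef, Real.le_logb_iff_rpow_le (by norm_num) hN1pos]
    have : (2 : ℝ) ^ ((D : ℝ) + 12) = 2 ^ (D + 12) := by
      rw [← Real.rpow_natCast]
      push_cast
      rfl
    rw [this]
    exact hN1big
  have hD0 : (0 : ℝ) ≤ D := Nat.cast_nonneg D
  have hL0 : 0 < L := by linarith
  set m := ⌊(L - D) / 12⌋₊ with hm
  have hm1 : 12 * (m : ℝ) ≤ L - D := by
    have := Nat.floor_le (by apply div_nonneg <;> linarith : 0 ≤ (L - D) / 12)
    rw [← hm] at this
    linarith
  have hm2 : L - (D + 12) ≤ 12 * (m : ℝ) := by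
    have := Nat.lt_floor_add_one ((L - D) / 12)
    rw [← hm] at this
    linarith
  have hmL : 12 * m ≤ ⌊L⌋₊ := by
    apply Nat.le_floor
    push_cast
    linarith
  have hpow : ((2 ^ (12 * m) : ℕ) : ℝ) * 2 ^ D ≤ N₁ := by
    have h1 : (2 : ℝ) ^ ((12 * m + D : ℕ) : ℝ) ≤ N₁ := by
      rw [← Real.le_logb_iff_rpow_le (by norm_num) hN1pos, ← hLdef]
      push_cast
      linarith
    rw [Real.rpow_natCast, pow_add] at h1
    push_cast
    exact h1
  have hS : ∀ v ∈ Fintype.piFinset (fun _ : Fin k => Finset.Icc 1 (12 * m)),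
      (∑ j, 2 ^ (v j)) + 2 ≤ N₂ := by
    intro v hv
    rw [Fintype.mem_piFinset] at hv
    have h1 : ∑ j, 2 ^ (v j) ≤ k * 2 ^ (12 * m) := by
      calc ∑ j, 2 ^ (v j) ≤ ∑ _j : Fin k, 2 ^ (12 * m) := by
            refine Finset.sum_le_sum fun j _ => ?_
            exact Nat.pow_le_pow_right (by norm_num) (Finset.mem_Icc.1 (hv j)).2
        _ = _ := by simp
    have h2 : 2 * (k * ((2 ^ (12 * m) : ℕ) : ℝ)) ≤ N₂ := by
      have h3 : ((2 ^ (12 * m) : ℕ) : ℝ) * (2 * k * c) ≤ c * N₂ :=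
        le_trans (mul_le_mul_of_nonneg_left hD (Nat.cast_nonneg _)) (le_trans hpow hle)
      have h4 : c * (2 * (k * ((2 ^ (12 * m) : ℕ) : ℝ))) ≤ c * N₂ := by linarith
      exact le_of_mul_le_mul_left h4 (by linarith)
    have h5 : 2 * (k * 2 ^ (12 * m)) ≤ N₂ := by exact_mod_cast h2
    have h6 : 2 ^ 12 ≤ 2 ^ (D + 12) := Nat.pow_le_pow_right (by norm_num) (by omega)
    omega
  have hsub : Fintype.piFinset (fun _ : Fin k => Finset.Icc 1 (12 * m)) ⊆
      (Fintype.piFinset fun _ : Fin k => Finset.Icc 1 ⌊L⌋₊).filter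
        (fun v => (∑ j, 2 ^ (v j)) + 2 ≤ N₁ ∧ (∑ j, 2 ^ (v j)) + 2 ≤ N₂) := by
    intro v hv
    have h := hS v hv
    rw [Fintype.mem_piFinset] at hv
    rw [Finset.mem_filter, Fintype.mem_piFinset]
    refine ⟨fun j => ?_, by omega, h⟩
    have := Finset.mem_Icc.1 (hv j)
    exact Finset.mem_Icc.2 ⟨this.1, by omega⟩
  have havg := WW_avg k m (by omega) (N₁ : GG) (N₂ : GG)
  calc 3.261435 * L ^ k - 3.261435 * (k * (D + 12)) * L ^ (k - 1)
      = 3.261435 * (L ^ k - k * (D + 12) * L ^ (k - 1)) := by ring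
    _ ≤ 3.261435 * (L - (D + 12)) ^ k := by
        apply mul_le_mul_of_nonneg_left _ (by norm_num)
        exact bern_aux L (D + 12) k (by omega) hL0 hLD
    _ ≤ 3.261435 * (12 * (m : ℝ)) ^ k := by
        apply mul_le_mul_of_nonneg_left _ (by norm_num)
        exact pow_le_pow_left₀ (by linarith) hm2 k
    _ = 1.837 ^ 2 * (3.261435 / 1.837 ^ 2 * (12 * (m : ℝ)) ^ k) := by
        rw [← mul_assoc]
        congr 1
        norm_num
    _ ≤ 1.837 ^ 2 * ∑ v ∈ Fintype.piFinset (fun _ : Fin k => Finset.Icc 1 (12 * m)),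
        WW ((N₁ : GG) - ((∑ j, 2 ^ (v j) : ℕ) : GG)) *
          WW ((N₂ : GG) - ((∑ j, 2 ^ (v j) : ℕ) : GG)) :=
        mul_le_mul_of_nonneg_left havg (by norm_num)
    _ ≤ ∑ v ∈ Fintype.piFinset (fun _ : Fin k => Finset.Icc 1 (12 * m)),
          SSfun (N₁ - ∑ j, 2 ^ (v j)) * SSfun (N₂ - ∑ j, 2 ^ (v j)) := by
        rw [Finset.mul_sum]
        refine Finset.sum_le_sum fun v hv => ?_
        have h := hS v hv
        rw [Fintype.mem_piFinset] at hv
        have hev := even_sum_pow k v fun j => (Finset.mem_Icc.1 (hv j)).1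
        rw [← Nat.cast_sub (by omega), ← Nat.cast_sub (by omega)]
        have e1 := SSfun_lower _ (hN₁.tsub hev)
        have e2 := SSfun_lower _ (hN₂.tsub hev)
        refine le_trans (le_of_eq ?_) (mul_le_mul e1 e2
          (mul_nonneg (by norm_num) (WW_nonneg _)) (SSfun_nonneg _ (hN₁.tsub hev)))
        ring
    _ ≤ _ := by
        refine Finset.sum_le_sum_of_subset_of_nonneg hsub fun v hv _ => ?_
        rw [Finset.mem_filter, Fintype.mem_piFinset] at hv
        have hev := even_sum_pow k v fun j => (Finset.mem_Icc.1 (hv.1 j)).1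
        exact mul_nonneg (SSfun_nonneg _ (hN₁.tsub hev)) (SSfun_nonneg _ (hN₂.tsub hev))
end
end

section
/- For every integer k ≥ 27 there exists a constant C > 0 such that for every integer M and every real L ≥ 2, the number of k-tuples of integers (v₁, ..., v_k) with 1 ≤ v_j ≤ L for each j and 2^{v₁} + 2^{v₂} + ... + 2^{v_k} ≡ M (mod 273) is at least 0.0036629·L^k − C·L^{k−1}. -/
open MeasureTheory Finset
open scoped Classical

noncomputable section

/-- Powers of two modulo 273. -/
def powList : List ℕ := [2, 4, 8, 16, 32, 64, 128, 256, 239, 205, 137, 1]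

/-- One convolution step on tables of length 273. -/
def stepList (l : List ℕ) : List ℕ :=
  powList.foldr (fun s acc => List.zipWith (fun x y => x + y) (l.rotate s) acc)
    (List.replicate 273 0)

/-- Tables of counts. -/
def tabList : ℕ → List ℕ
  | 0 => 1 :: List.replicate 272 0
  | k + 1 => stepList (tabList k)

/-- Counting function for one period. -/
def fcount : ℕ → ℕ → ℕ
  | 0, i => if i % 273 = 0 then 1 else 0
  | k + 1, i => (powList.map (fun s => fcount k (i + s))).sum

theorem fcount_mod (k i : ℕ) : fcount k (i % 273) = fcount k i := by
  induction k generalizing i with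
  | zero => simp [fcount]
  | succ k ih =>
    simp only [fcount]
    congr 1
    apply List.map_congr_left
    intro s _
    rw [← ih (i % 273 + s), ← ih (i + s), Nat.mod_add_mod]

theorem fcount_congr (k : ℕ) {i j : ℕ} (h : i % 273 = j % 273) : fcount k i = fcount k j := by
  rw [← fcount_mod, h, fcount_mod]

theorem rotate_tab (f : ℕ → ℕ) (hf : ∀ i, f (i % 273) = f i) (s : ℕ) :
    ((List.range 273).map f).rotate s = (List.range 273).map (fun i => f (i + s)) := by
  apply List.ext_getElem
  · simp
  · intro i h1 h2
    rw [List.getElem_rotate]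
    simp [hf]

theorem step_tab (f : ℕ → ℕ) (hf : ∀ i, f (i % 273) = f i) (S : List ℕ) :
    S.foldr (fun s acc => List.zipWith (fun x y => x + y) (((List.range 273).map f).rotate s) acc)
      (List.replicate 273 0) =
    (List.range 273).map (fun i => (S.map (fun s => f (i + s))).sum) := by
  induction S with
  | nil =>
    rw [List.foldr_nil]
    apply List.ext_getElem
    · rw [List.length_replicate, List.length_map, List.length_range]
    · intro i h1 h2
      rw [List.getElem_replicate, List.getElem_map]
      rfl
  | cons s S ih =>
    rw [List.foldr_cons, ih, rotate_tab f hf, List.zipWith_map, List.zipWith_self]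
    simp

theorem tabList_eq (k : ℕ) : tabList k = (List.range 273).map (fcount k) := by
  induction k with
  | zero => decide +kernel
  | succ k ih =>
    rw [tabList, ih, stepList, step_tab _ (fcount_mod k)]
    rfl

theorem tab_bound : ∀ x ∈ tabList 27, 36629 * 12 ^ 27 ≤ 10 ^ 7 * x := by
  decide +kernel

theorem fcount_bound (k : ℕ) (hk : 27 ≤ k) (i : ℕ) :
    36629 * 12 ^ k ≤ 10 ^ 7 * fcount k i := by
  induction k, hk using Nat.le_induction generalizing i with
  | base =>
    rw [← fcount_mod]
    apply tab_bound
    rw [tabList_eq]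
    exact List.mem_map_of_mem (List.mem_range.2 (Nat.mod_lt _ (by norm_num)))
  | succ k hk ih =>
    simp only [fcount, powList, List.map_cons, List.map_nil, List.sum_cons, List.sum_nil]
    have h1 := ih (i + 2)
    have h2 := ih (i + 4)
    have h3 := ih (i + 8)
    have h4 := ih (i + 16)
    have h5 := ih (i + 32)
    have h6 := ih (i + 64)
    have h7 := ih (i + 128)
    have h8 := ih (i + 256)
    have h9 := ih (i + 239)
    have h10 := ih (i + 205)
    have h11 := ih (i + 137)
    have h12 := ih (i + 1)
    rw [pow_succ]
    linarith

/-- Number of tuples with entries up to `n` and prescribed residue. -/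
def tupCount (n k i : ℕ) : ℕ :=
  ((Fintype.piFinset fun _ : Fin k => Finset.Icc 1 n).filter
    (fun v => (i + ∑ j, 2 ^ (v j)) % 273 = 0)).card

theorem tupCount_succ (n k i : ℕ) :
    tupCount n (k + 1) i = ∑ a ∈ Finset.Icc 1 n, tupCount n k (i + 2 ^ a) := by
  unfold tupCount
  rw [← Finset.card_sigma]
  refine Finset.card_bij' (fun v _ => ⟨v 0, fun j => v j.succ⟩)
    (fun p _ => Fin.cons p.1 p.2) ?_ ?_ ?_ ?_
  · intro v hv
    simp only [Finset.mem_filter, Fintype.mem_piFinset, Finset.mem_sigma, Fin.sum_univ_succ] at hv ⊢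
    exact ⟨hv.1 0, fun j => hv.1 j.succ, by rw [add_assoc]; exact hv.2⟩
  · rintro ⟨a, v⟩ hv
    simp only [Finset.mem_filter, Fintype.mem_piFinset, Finset.mem_sigma, Fin.sum_univ_succ,
      Fin.cons_zero, Fin.cons_succ] at hv ⊢
    refine ⟨fun j => ?_, by rw [← add_assoc]; exact hv.2.2⟩
    refine Fin.cases ?_ (fun j => ?_) j
    · simpa using hv.1
    · simpa using hv.2.1 j
  · intro v _
    funext j
    refine Fin.cases ?_ (fun j => ?_) j <;> simp
  · rintro ⟨a, v⟩ _
    simp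

theorem sum_period_s6 (m k i : ℕ) :
    ∑ a ∈ Finset.Icc 1 (12 * m), fcount k (i + 2 ^ a) = m * fcount (k + 1) i := by
  induction m with
  | zero => simp
  | succ m ih =>
    have key : ∀ j s : ℕ, 2 ^ j % 273 = s % 273 →
        fcount k (i + 2 ^ (12 * m + j)) = fcount k (i + s) := by
      intro j s h
      apply fcount_congr
      apply Nat.ModEq.add_left
      have h1 : (2 ^ 12) ^ m ≡ 1 ^ m [MOD 273] := Nat.ModEq.pow m (by decide)
      have h2 := h1.mul (show 2 ^ j ≡ s [MOD 273] from h)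
      rw [pow_add, pow_mul]
      simpa using h2
    have e : 12 * (m + 1) = 12 * m + 11 + 1 := by ring
    rw [e]
    iterate 12 rw [Finset.sum_Icc_succ_top (by omega)]
    rw [ih, add_mul, one_mul]
    simp only [add_assoc, Nat.reduceAdd]
    rw [key 1 2 (by norm_num), key 2 4 (by norm_num), key 3 8 (by norm_num),
      key 4 16 (by norm_num), key 5 32 (by norm_num), key 6 64 (by norm_num),
      key 7 128 (by norm_num), key 8 256 (by norm_num), key 9 239 (by norm_num),
      key 10 205 (by norm_num), key 11 137 (by norm_num), key 12 1 (by norm_num)]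
    simp [fcount, powList]

theorem tupCount_period (m k i : ℕ) : tupCount (12 * m) k i = m ^ k * fcount k i := by
  induction k generalizing i with
  | zero =>
    by_cases h : i % 273 = 0 <;> simp [tupCount, fcount, h]
  | succ k ih =>
    rw [tupCount_succ]
    simp only [ih]
    rw [← Finset.mul_sum, sum_period_s6, pow_succ]
    ring

theorem pow_diff (k : ℕ) (x L : ℝ) (hx : 0 ≤ x) (h : x ≤ L) (hd : L - 12 ≤ x) :
    L ^ (k + 1) - 12 * (k + 1) * L ^ k ≤ x ^ (k + 1) := by
  induction k with
  | zero => simp; linarith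
  | succ k ih =>
    have hL : 0 ≤ L := hx.trans h
    have h1 : x ^ (k + 1) ≤ L ^ (k + 1) := pow_le_pow_left₀ hx h _
    have h2 := mul_le_mul_of_nonneg_right ih hL
    have h3 : x ^ (k + 1) * (L - x) ≤ L ^ (k + 1) * 12 :=
      mul_le_mul h1 (by linarith) (by linarith) (by positivity)
    rw [pow_succ x (k + 1), pow_succ L (k + 1)]
    rw [pow_succ L k] at *
    push_cast
    nlinarith

/-- For `k ≥ 27`, the number of `k`-tuples `(v₁,…,v_k)` of integers `1 ≤ v_j ≤ L` with
`2^{v₁} + ⋯ + 2^{v_k} ≡ M (mod 273)` is at least `0.0036629 L^k - C L^{k-1}`. -/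
theorem count_power_tuples_mod_273 (k : ℕ) (hk : 27 ≤ k) :
    ∃ C > (0 : ℝ), ∀ M : ℤ, ∀ L : ℝ, 2 ≤ L →
      0.0036629 * L ^ k - C * L ^ (k - 1) ≤
        (((Fintype.piFinset fun _ : Fin k => Finset.Icc 1 ⌊L⌋₊).filter
          (fun v => Int.ModEq 273 (∑ j, (2 : ℤ) ^ (v j)) M)).card : ℝ) := by
  obtain ⟨k, rfl⟩ : ∃ k', k = k' + 1 := ⟨k - 1, by omega⟩
  refine ⟨12 * (k + 1), by positivity, fun M L hL => ?_⟩
  set n := ⌊L⌋₊ with hn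
  set m := n / 12 with hm
  set i := ((-M) % 273).toNat with hi
  have hi' : (i : ℤ) = (-M) % 273 := by omega
  have hsub : tupCount (12 * m) (k + 1) i ≤
      ((Fintype.piFinset fun _ : Fin (k + 1) => Finset.Icc 1 n).filter
          (fun v => Int.ModEq 273 (∑ j, (2 : ℤ) ^ (v j)) M)).card := by
    apply Finset.card_le_card
    intro v hv
    simp only [Finset.mem_filter, Fintype.mem_piFinset, Finset.mem_Icc] at hv ⊢
    refine ⟨fun j => ⟨(hv.1 j).1, (hv.1 j).2.trans (by omega)⟩, ?_⟩
    have h2 := hv.2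
    have h3 : ((∑ j, 2 ^ (v j) : ℕ) : ℤ) = ∑ j, (2 : ℤ) ^ (v j) := by push_cast; rfl
    rw [← h3]
    unfold Int.ModEq
    omega
  rw [tupCount_period] at hsub
  have hb := fcount_bound (k + 1) hk i
  have hnL : (n : ℝ) ≤ L := Nat.floor_le (by linarith)
  have hLn : L < n + 1 := Nat.lt_floor_add_one L
  have h12 : 12 * m ≤ n := by omega
  have h12' : n ≤ 12 * m + 11 := by omega
  have h12r : (12 * m : ℝ) ≤ n := by exact_mod_cast h12
  have h12r' : (n : ℝ) ≤ 12 * m + 11 := by exact_mod_cast h12'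
  have hp := pow_diff k (12 * m) L (by positivity) (by linarith) (by linarith)
  have hb' : (36629 * 12 ^ (k + 1) : ℝ) ≤ 10 ^ 7 * fcount (k + 1) i := by exact_mod_cast hb
  have hs' : ((m : ℝ) ^ (k + 1) * fcount (k + 1) i) ≤
      (((Fintype.piFinset fun _ : Fin (k + 1) => Finset.Icc 1 n).filter
          (fun v => Int.ModEq 273 (∑ j, (2 : ℤ) ^ (v j)) M)).card : ℝ) := by exact_mod_cast hsub
  refine le_trans ?_ hs'
  have hmul := mul_le_mul_of_nonneg_left hb' (show (0 : ℝ) ≤ (m : ℝ) ^ (k + 1) by positivity)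
  rw [mul_pow] at hp
  have hq : (0 : ℝ) ≤ 12 * (k + 1) * L ^ k := by positivity
  rw [Nat.add_sub_cancel]
  have e1 : (0.0036629 : ℝ) = 36629 / 10 ^ 7 := by norm_num
  rw [e1]
  generalize (fcount (k + 1) i : ℝ) = F at *
  generalize (m : ℝ) ^ (k + 1) = A at *
  generalize (12 : ℝ) ^ (k + 1) = B at *
  generalize L ^ (k + 1) = X at *
  generalize (12 * (k + 1) * L ^ k : ℝ) = Y at *
  clear hsub hs' hb
  linarith
end
end
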